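/- For any convex polytope P and any face F of P, g_1(P,F) = dim_ℝ (Aff(V_P)/Aff(V_N)), where V_P is the set of vertices of P, V_N is the set of vertices of P lying in N(P,F), and Aff(V_N) is embedded in Aff(V_P) by extension by zero. -/

import Mathlib

open Polynomial
open scoped Classical

noncomputable section

/-- `P ⊆ ℝ^d` is a (convex) polytope: the convex hull of a finite set of points. -/
def IsPolytope {d : ℕ} (P : Set (Fin d → ℝ)) : Prop :=
  ∃ S : Finset (Fin d → ℝ), P = convexHull ℝ (S : Set (Fin d → ℝ))

/-- `F` is a face of `P`: the empty set, `P` itself, or the intersection of `P`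
with a supporting hyperplane. -/
def IsFace {d : ℕ} (P F : Set (Fin d → ℝ)) : Prop :=
  F = ∅ ∨ F = P ∨ ∃ (f : (Fin d → ℝ) →ₗ[ℝ] ℝ) (c : ℝ),
    (∀ x ∈ P, f x ≤ c) ∧ F = {x ∈ P | f x = c}

/-- Affine dimension of a subset of `ℝ^d`, with `pdim ∅ = -1`. -/
def pdim {d : ℕ} (P : Set (Fin d → ℝ)) : ℤ :=
  if P = ∅ then -1 else (Module.finrank ℝ (affineSpan ℝ P).direction : ℤ)

/-- The pair of functions `g`, `h` satisfies the defining recursion of the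
`g`- and `h`-polynomials of polytopes. -/
def IsGH {d : ℕ} (g h : Set (Fin d → ℝ) → Polynomial ℤ) : Prop :=
  g ∅ = 1 ∧
  (∀ P : Set (Fin d → ℝ), IsPolytope P →
      h P = ∑ᶠ F ∈ {F : Set (Fin d → ℝ) | IsFace P F ∧ F ≠ P},
        (X - 1 : Polynomial ℤ) ^ (pdim P - pdim F - 1).toNat * g F) ∧
  (∀ P : Set (Fin d → ℝ), IsPolytope P → P ≠ ∅ →
      (g P).coeff 0 = (h P).coeff 0 ∧
      (∀ i : ℕ, 0 < i → 2 * (i : ℤ) ≤ pdim P →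
        (g P).coeff i = (h P).coeff i - (h P).coeff (i - 1)) ∧
      (∀ i : ℕ, 0 < i → ¬(2 * (i : ℤ) ≤ pdim P) → (g P).coeff i = 0))

/-- `Q` is (a combinatorial model of) the quotient polytope `P/E`, with `ψ` an
explicit isomorphism from the interval `[E, P]` in the face poset of `P` to the
face poset of `Q`. -/
def IsQuotientPair {d : ℕ} (P E Q : Set (Fin d → ℝ))
    (ψ : Set (Fin d → ℝ) → Set (Fin d → ℝ)) : Prop :=
  IsPolytope Q ∧
  Set.BijOn ψ {G : Set (Fin d → ℝ) | IsFace P G ∧ E ⊆ G} {G : Set (Fin d → ℝ) | IsFace Q G} ∧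
  ∀ G₁ ∈ {G : Set (Fin d → ℝ) | IsFace P G ∧ E ⊆ G},
    ∀ G₂ ∈ {G : Set (Fin d → ℝ) | IsFace P G ∧ E ⊆ G}, (G₁ ⊆ G₂ ↔ ψ G₁ ⊆ ψ G₂)

/-- The family `gr` of relative `g`-polynomials satisfies the defining relation
`∑_{F ≤ E ≤ P} g(E,F) g(P/E) = g(P)` (where `g(P/P) = 1`, the quotient by `P`
itself being the empty polytope). -/
def IsRelG {d : ℕ} (g : Set (Fin d → ℝ) → Polynomial ℤ)
    (gr : Set (Fin d → ℝ) → Set (Fin d → ℝ) → Polynomial ℤ) : Prop :=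
  ∀ (P F : Set (Fin d → ℝ)) (Q : Set (Fin d → ℝ) → Set (Fin d → ℝ))
    (ψ : Set (Fin d → ℝ) → Set (Fin d → ℝ) → Set (Fin d → ℝ)),
    IsPolytope P → IsFace P F →
    (∀ E, IsFace P E → F ⊆ E → IsQuotientPair P E (Q E) (ψ E)) →
    (∑ᶠ E ∈ {E : Set (Fin d → ℝ) | IsFace P E ∧ F ⊆ E}, gr E F * g (Q E)) = g P

/-- A rational polytope: the convex hull of finitely many points with rational
coordinates. -/
def IsRationalPolytope {d : ℕ} (P : Set (Fin d → ℝ)) : Prop :=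
  ∃ S : Finset (Fin d → ℝ), (∀ v ∈ S, ∀ i : Fin d, ∃ q : ℚ, v i = (q : ℝ)) ∧
    P = convexHull ℝ (S : Set (Fin d → ℝ))

/-- The space `Aff(V)` of affine dependencies among the points of `V ⊆ ℝ^d`,
realized as the submodule of finitely supported functions `a : ℝ^d → ℝ` supported
in `V` with `∑ a_v = 0` and `∑ a_v • v = 0`. -/
def AffDep {d : ℕ} (V : Set (Fin d → ℝ)) : Submodule ℝ ((Fin d → ℝ) → ℝ) where
  carrier := {a | (Function.support a).Finite ∧ Function.support a ⊆ V ∧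
    (∑ᶠ v, a v) = 0 ∧ (∑ᶠ v, a v • v) = 0}
  zero_mem' := by
    refine ⟨by simp, by simp, by simp, by simp⟩
  add_mem' := by
    rintro a b ⟨ha1, ha2, ha3, ha4⟩ ⟨hb1, hb2, hb3, hb4⟩
    have hs : Function.support (a + b) ⊆ Function.support a ∪ Function.support b :=
      Function.support_add a b
    have hva : (Function.support fun v => a v • v) ⊆ Function.support a := by
      intro x hx
      simp only [Function.mem_support] at hx ⊢
      intro hax; exact hx (by simp [hax])
    have hvb : (Function.support fun v => b v • v) ⊆ Function.support b := by
      intro x hx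
      simp only [Function.mem_support] at hx ⊢
      intro hbx; exact hx (by simp [hbx])
    refine ⟨(ha1.union hb1).subset hs, hs.trans (Set.union_subset ha2 hb2), ?_, ?_⟩
    · have := finsum_add_distrib ha1 hb1
      simpa [Pi.add_apply, ha3, hb3] using this.symm ▸ (by rw [ha3, hb3, add_zero] : (∑ᶠ v, a v) + (∑ᶠ v, b v) = 0)
    · have h2 := finsum_add_distrib (ha1.subset hva) (hb1.subset hvb)
      have : (∑ᶠ v, ((a + b) v) • v) = (∑ᶠ v, (a v • v + b v • v)) := by
        congr 1; funext v; simp [add_smul]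
      rw [this, h2, ha4, hb4, add_zero]
  smul_mem' := by
    intro c a ⟨ha1, ha2, ha3, ha4⟩
    have hs : Function.support (c • a) ⊆ Function.support a := by
      intro x hx
      simp only [Function.mem_support, Pi.smul_apply, smul_eq_mul] at hx ⊢
      intro hax; exact hx (by rw [hax, mul_zero])
    refine ⟨ha1.subset hs, hs.trans ha2, ?_, ?_⟩
    · have : (∑ᶠ v, (c • a) v) = c • ∑ᶠ v, a v := by
        rw [smul_finsum]
        congr 1
      rw [this, ha3, smul_zero]
    · have : (∑ᶠ v, ((c • a) v) • v) = c • ∑ᶠ v, (a v) • v := by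
        rw [smul_finsum]
        congr 1; funext v; simp [smul_smul]
      rw [this, ha4, smul_zero]

/-- `N(P,F)`: the union of all facets of `P` containing the face `F`. -/
def NPF {d : ℕ} (P F : Set (Fin d → ℝ)) : Set (Fin d → ℝ) :=
  ⋃₀ {G : Set (Fin d → ℝ) | IsFace P G ∧ pdim G = pdim P - 1 ∧ F ⊆ G}


/-- Homogenization of a point. -/
def hat {d : ℕ} (x : Fin d → ℝ) : (Fin d → ℝ) × ℝ := (x, 1)

/-- Span of the homogenization of a set. -/
def hspan {d : ℕ} (X : Set (Fin d → ℝ)) : Submodule ℝ ((Fin d → ℝ) × ℝ) :=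
  Submodule.span ℝ (hat '' X)

def rk {d : ℕ} (X : Set (Fin d → ℝ)) : ℕ := Module.finrank ℝ (hspan X)

lemma hat_comb {d : ℕ} (x y : Fin d → ℝ) (a b : ℝ) (hab : a + b = 1) :
    hat (a • x + b • y) = a • hat x + b • hat y := by
  simp [hat, hab]

lemma isFace_iff {d : ℕ} {P F : Set (Fin d → ℝ)} :
    IsFace P F ↔ ∃ φ : ((Fin d → ℝ) × ℝ) →ₗ[ℝ] ℝ,
      (∀ x ∈ P, 0 ≤ φ (hat x)) ∧ F = {x ∈ P | φ (hat x) = 0} := by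
  constructor
  · rintro (h | h | ⟨f, c, h1, h2⟩)
    · refine ⟨LinearMap.snd ℝ _ _, ?_, ?_⟩
      · intro x _; simp [hat]
      · simp [hat, h]
    · exact ⟨0, by simp, by simp [h]⟩
    · refine ⟨c • LinearMap.snd ℝ _ _ - f.comp (LinearMap.fst ℝ _ _), ?_, ?_⟩
      · intro x hx
        have := h1 x hx
        simp [hat, this]
      · rw [h2]; ext x
        simp only [Set.mem_ofPred_eq, hat, LinearMap.sub_apply, LinearMap.smul_apply,
          LinearMap.snd_apply, LinearMap.comp_apply, LinearMap.fst_apply, smul_eq_mul, mul_one]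
        constructor
        · rintro ⟨a, b⟩; exact ⟨a, by linarith⟩
        · rintro ⟨a, b⟩; exact ⟨a, by linarith⟩
  · rintro ⟨φ, h1, h2⟩
    have key : ∀ x, φ (hat x) = φ (x, 0) + φ (0, 1) := by
      intro x; rw [← map_add]; simp [hat]
    refine Or.inr (Or.inr ⟨-(φ.comp (LinearMap.inl ℝ _ _)), φ (0, 1), ?_, ?_⟩)
    · intro x hx
      have := h1 x hx
      rw [key] at this
      simp; linarith
    · rw [h2]; ext x
      simp only [Set.mem_ofPred_eq, key, LinearMap.neg_apply, LinearMap.comp_apply,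
        LinearMap.inl_apply]
      constructor
      · rintro ⟨a, b⟩; exact ⟨a, by linarith⟩
      · rintro ⟨a, b⟩; exact ⟨a, by linarith⟩

lemma isFace_empty {d : ℕ} (P : Set (Fin d → ℝ)) : IsFace P ∅ := Or.inl rfl

lemma isFace_self {d : ℕ} (P : Set (Fin d → ℝ)) : IsFace P P := Or.inr (Or.inl rfl)

lemma IsFace.subset {d : ℕ} {P F : Set (Fin d → ℝ)} (h : IsFace P F) : F ⊆ P := by
  obtain ⟨φ, h1, h2⟩ := isFace_iff.1 h
  rw [h2]; exact fun x hx => hx.1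

lemma IsFace.inter {d : ℕ} {P F G : Set (Fin d → ℝ)} (h : IsFace P F) (h' : IsFace P G) :
    IsFace P (F ∩ G) := by
  obtain ⟨φ, h1, h2⟩ := isFace_iff.1 h
  obtain ⟨χ, h3, h4⟩ := isFace_iff.1 h'
  refine isFace_iff.2 ⟨φ + χ, fun x hx => add_nonneg (h1 x hx) (h3 x hx), ?_⟩
  rw [h2, h4]
  ext x
  simp only [Set.mem_inter_iff, Set.mem_ofPred_eq, LinearMap.add_apply]
  constructor
  · rintro ⟨⟨a, b⟩, _, c⟩; exact ⟨a, by rw [b, c, add_zero]⟩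
  · rintro ⟨a, b⟩
    have := h1 x a
    have := h3 x a
    exact ⟨⟨a, by linarith⟩, a, by linarith⟩

lemma IsFace.restrict {d : ℕ} {P F G : Set (Fin d → ℝ)} (h : IsFace P G) (hF : F ⊆ P)
    (hGF : G ⊆ F) : IsFace F G := by
  obtain ⟨φ, h1, h2⟩ := isFace_iff.1 h
  refine isFace_iff.2 ⟨φ, fun x hx => h1 x (hF hx), ?_⟩
  ext x
  constructor
  · intro hx
    have := hx
    rw [h2] at this
    exact ⟨hGF hx, this.2⟩
  · rintro ⟨a, b⟩
    rw [h2]; exact ⟨hF a, b⟩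

lemma nonneg_conv {d : ℕ} {S : Set (Fin d → ℝ)} {φ : ((Fin d → ℝ) × ℝ) →ₗ[ℝ] ℝ}
    (h : ∀ x ∈ S, 0 ≤ φ (hat x)) :
    (∀ x ∈ convexHull ℝ S, 0 ≤ φ (hat x)) ∧
    {x ∈ convexHull ℝ S | φ (hat x) = 0} = convexHull ℝ {x ∈ S | φ (hat x) = 0} := by
  have key : convexHull ℝ S ⊆ {x | 0 ≤ φ (hat x) ∧
      (φ (hat x) = 0 → x ∈ convexHull ℝ {x ∈ S | φ (hat x) = 0})} := by
    apply convexHull_min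
    · intro x hx
      exact ⟨h x hx, fun h0 => subset_convexHull ℝ _ ⟨hx, h0⟩⟩
    · intro x hx y hy a b ha hb hab
      simp only [Set.mem_ofPred_eq] at hx hy ⊢
      rw [hat_comb x y a b hab, map_add, map_smul, map_smul, smul_eq_mul, smul_eq_mul]
      have h1 := mul_nonneg ha hx.1
      have h2 := mul_nonneg hb hy.1
      refine ⟨add_nonneg h1 h2, fun h0 => ?_⟩
      have h3 : a * φ (hat x) = 0 := by linarith
      have h4 : b * φ (hat y) = 0 := by linarith
      rcases mul_eq_zero.1 h3 with h3 | h3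
      · have : b = 1 := by linarith
        subst h3; subst this
        simpa using hy.2 (by simpa using h4)
      · rcases mul_eq_zero.1 h4 with h4 | h4
        · have : a = 1 := by linarith
          subst h4; subst this
          simpa using hx.2 (by simpa using h3)
        · exact convex_convexHull ℝ _ (hx.2 h3) (hy.2 h4) ha hb hab
  refine ⟨fun x hx => (key hx).1, ?_⟩
  apply Set.Subset.antisymm
  · rintro x ⟨hx, h0⟩
    exact (key hx).2 h0
  · apply convexHull_min
    · rintro x ⟨hx, h0⟩
      exact ⟨subset_convexHull ℝ _ hx, h0⟩
    · rintro x ⟨hx, hx0⟩ y ⟨hy, hy0⟩ a b ha hb hab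
      refine ⟨convex_convexHull ℝ _ hx hy ha hb hab, ?_⟩
      rw [hat_comb x y a b hab, map_add, map_smul, map_smul, hx0, hy0]; simp

lemma IsFace.eq_conv {d : ℕ} {S F : Set (Fin d → ℝ)} (h : IsFace (convexHull ℝ S) F) :
    F = convexHull ℝ (S ∩ F) := by
  obtain ⟨φ, h1, h2⟩ := isFace_iff.1 h
  have h3 := (nonneg_conv (S := S) (φ := φ) (fun x hx => h1 x (subset_convexHull ℝ _ hx))).2
  have h4 : S ∩ F = {x ∈ S | φ (hat x) = 0} := by
    ext x
    rw [h2]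
    constructor
    · rintro ⟨a, b⟩; exact ⟨a, b.2⟩
    · rintro ⟨a, b⟩; exact ⟨a, subset_convexHull ℝ _ a, b⟩
  rw [h4, ← h3, h2]

lemma isFace_conv {d : ℕ} {S : Set (Fin d → ℝ)} {φ : ((Fin d → ℝ) × ℝ) →ₗ[ℝ] ℝ}
    (h : ∀ x ∈ S, 0 ≤ φ (hat x)) :
    IsFace (convexHull ℝ S) (convexHull ℝ {x ∈ S | φ (hat x) = 0}) :=
  isFace_iff.2 ⟨φ, (nonneg_conv h).1, (nonneg_conv h).2.symm⟩

lemma IsFace.isPolytope {d : ℕ} {P F : Set (Fin d → ℝ)} (hP : IsPolytope P) (h : IsFace P F) :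
    IsPolytope F := by
  obtain ⟨S, rfl⟩ := hP
  have hf : ((S : Set (Fin d → ℝ)) ∩ F).Finite := S.finite_toSet.inter_of_left F
  exact ⟨hf.toFinset, by rw [hf.coe_toFinset]; exact h.eq_conv⟩

lemma faces_finite {d : ℕ} {P : Set (Fin d → ℝ)} (hP : IsPolytope P) :
    {F | IsFace P F}.Finite := by
  obtain ⟨S, rfl⟩ := hP
  have hfin : (Set.powerset (S : Set (Fin d → ℝ))).Finite := S.finite_toSet.powerset
  apply (hfin.image (fun T => convexHull ℝ T)).subset
  intro F hF
  exact ⟨(S : Set (Fin d → ℝ)) ∩ F, Set.inter_subset_left, hF.eq_conv.symm⟩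

lemma IsFace.trans {d : ℕ} {P F G : Set (Fin d → ℝ)} (hP : IsPolytope P) (h : IsFace P F)
    (h' : IsFace F G) : IsFace P G := by
  obtain ⟨S, rfl⟩ := hP
  have hF := h.eq_conv
  have hG : G = convexHull ℝ ((S : Set (Fin d → ℝ)) ∩ F ∩ G) := by
    rw [hF] at h'
    exact h'.eq_conv
  have hFP := h.subset
  have hGF := h'.subset
  obtain ⟨φ, h1, h2⟩ := isFace_iff.1 h
  obtain ⟨χ, h3, h4⟩ := isFace_iff.1 h'
  have : ∃ N : ℝ, ∀ s ∈ S, s ∉ F → 0 < N * φ (hat s) + χ (hat s) := by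
    have hb : ∀ s ∈ S, ∃ N : ℝ, ∀ M ≥ N, s ∉ F → 0 < M * φ (hat s) + χ (hat s) := by
      intro s hs
      by_cases hsF : s ∈ F
      · exact ⟨0, fun _ _ h => absurd hsF h⟩
      · have hpos : 0 < φ (hat s) := by
          have hsP : s ∈ convexHull ℝ (S : Set (Fin d → ℝ)) := subset_convexHull ℝ _ hs
          refine lt_of_le_of_ne (h1 s hsP) (fun h0 => hsF ?_)
          rw [h2]; exact ⟨hsP, h0.symm⟩
        refine ⟨(1 - χ (hat s)) / φ (hat s), fun M hM _ => ?_⟩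
        have := (div_le_iff₀ hpos).1 hM
        linarith
    choose! N hN using hb
    obtain ⟨M, hM⟩ := (S.image N).bddAbove
    exact ⟨M, fun s hs => hN s hs M (hM (by simpa using ⟨s, hs, rfl⟩))⟩
  obtain ⟨N, hN⟩ := this
  have hz : ∀ s ∈ S, s ∈ F → (N • φ + χ) (hat s) = χ (hat s) := by
    intro s hs hsF
    rw [h2] at hsF
    simp [hsF.2]
  have hconv := isFace_conv (S := (S : Set (Fin d → ℝ))) (φ := N • φ + χ) (by
    intro s hs
    by_cases hsF : s ∈ F
    · rw [hz s hs hsF]; exact h3 s hsF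
    · exact (hN s hs hsF).le)
  convert hconv using 1
  rw [hG]
  congr 1
  ext s
  constructor
  · rintro ⟨⟨a, b⟩, c⟩
    refine ⟨a, ?_⟩
    rw [hz s a b]
    rw [h4] at c
    exact c.2
  · rintro ⟨a, b⟩
    have hsF : s ∈ F := by
      by_contra hsF
      exact (hN s a hsF).ne' b
    rw [hz s a hsF] at b
    exact ⟨⟨a, hsF⟩, by rw [h4]; exact ⟨hsF, b⟩⟩

lemma hspan_mono {d : ℕ} {X Y : Set (Fin d → ℝ)} (h : X ⊆ Y) : hspan X ≤ hspan Y :=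
  Submodule.span_mono (Set.image_mono h)

lemma hat_mem_hspan {d : ℕ} {X : Set (Fin d → ℝ)} {x : Fin d → ℝ} (h : x ∈ X) :
    hat x ∈ hspan X := Submodule.subset_span ⟨x, h, rfl⟩

lemma rk_mono {d : ℕ} {X Y : Set (Fin d → ℝ)} (h : X ⊆ Y) : rk X ≤ rk Y :=
  Submodule.finrank_mono (hspan_mono h)

lemma hspan_conv {d : ℕ} (X : Set (Fin d → ℝ)) : hspan (convexHull ℝ X) = hspan X := by
  apply le_antisymm _ (hspan_mono (subset_convexHull ℝ X))
  unfold hspan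
  rw [Submodule.span_le]
  rintro _ ⟨x, hx, rfl⟩
  have : convexHull ℝ X ⊆ {x | hat x ∈ hspan X} := by
    apply convexHull_min
    · intro x hx; exact hat_mem_hspan hx
    · intro x hx y hy a b ha hb hab
      simp only [Set.mem_ofPred_eq]
      rw [hat_comb x y a b hab]
      exact add_mem (Submodule.smul_mem _ _ hx) (Submodule.smul_mem _ _ hy)
  exact this hx

lemma hspan_le_ker {d : ℕ} {X : Set (Fin d → ℝ)} {φ : ((Fin d → ℝ) × ℝ) →ₗ[ℝ] ℝ}
    (h : ∀ x ∈ X, φ (hat x) = 0) : hspan X ≤ LinearMap.ker φ := by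
  unfold hspan
  rw [Submodule.span_le]
  rintro _ ⟨x, hx, rfl⟩
  exact h x hx

lemma IsFace.hat_notMem {d : ℕ} {P F : Set (Fin d → ℝ)} (h : IsFace P F) {x : Fin d → ℝ}
    (hx : x ∈ P) (hxF : x ∉ F) : hat x ∉ hspan F := by
  obtain ⟨φ, h1, h2⟩ := isFace_iff.1 h
  intro hm
  have := hspan_le_ker (X := F) (φ := φ) (by rw [h2]; exact fun x hx => hx.2) hm
  exact hxF (by rw [h2]; exact ⟨hx, this⟩)

lemma rk_lt_of_notMem {d : ℕ} {X Y : Set (Fin d → ℝ)} (hXY : X ⊆ Y) {x : Fin d → ℝ}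
    (hx : x ∈ Y) (hn : hat x ∉ hspan X) : rk X < rk Y := by
  apply Submodule.finrank_lt_finrank_of_lt
  refine lt_of_le_of_ne (hspan_mono hXY) (fun h => hn ?_)
  rw [h]; exact hat_mem_hspan hx

lemma IsFace.eq_of_rk_le {d : ℕ} {P F G : Set (Fin d → ℝ)} (h : IsFace P F) (hGP : G ⊆ P)
    (hFG : F ⊆ G) (hr : rk G ≤ rk F) : F = G := by
  apply hFG.antisymm
  intro x hx
  by_contra hxF
  have := rk_lt_of_notMem hFG hx (h.hat_notMem (hGP hx) hxF)
  omega

lemma rk_empty {d : ℕ} : rk (∅ : Set (Fin d → ℝ)) = 0 := by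
  unfold rk hspan; rw [Set.image_empty, Submodule.span_empty]; simp

lemma pdim_eq {d : ℕ} (X : Set (Fin d → ℝ)) : pdim X = (rk X : ℤ) - 1 := by
  unfold pdim
  split_ifs with h
  · rw [h, rk_empty]; simp
  · obtain ⟨x0, hx0⟩ := Set.nonempty_iff_ne_empty.2 h
    rw [direction_affineSpan]
    let f : hspan X →ₗ[ℝ] ℝ := (LinearMap.snd ℝ (Fin d → ℝ) ℝ).comp (hspan X).subtype
    have h1 := LinearMap.finrank_range_add_finrank_ker f
    have hr : LinearMap.range f = ⊤ := by
      rw [LinearMap.range_eq_top]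
      intro t
      refine ⟨t • ⟨hat x0, hat_mem_hspan hx0⟩, ?_⟩
      simp [f, hat]
    have hker : Module.finrank ℝ (LinearMap.ker f) = Module.finrank ℝ (vectorSpan ℝ X) := by
      let e : (Fin d → ℝ) →ₗ[ℝ] ((Fin d → ℝ) × ℝ) := LinearMap.inl ℝ _ _
      have hmap : (LinearMap.ker f).map (hspan X).subtype = (vectorSpan ℝ X).map e := by
        apply le_antisymm
        · have hle : hspan X ≤ ((vectorSpan ℝ X).map e) ⊔ Submodule.span ℝ {hat x0} := by
            unfold hspan
            rw [Submodule.span_le]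
            rintro _ ⟨x, hx, rfl⟩
            have : hat x = e (x - x0) + hat x0 := by simp [e, hat]
            rw [this]
            exact Submodule.add_mem_sup (Submodule.mem_map_of_mem (vsub_mem_vectorSpan ℝ hx hx0))
              (Submodule.mem_span_singleton_self _)
          rintro _ ⟨⟨w, hw⟩, hw0, rfl⟩
          obtain ⟨y, hy, z, hz, hyz⟩ := Submodule.mem_sup.1 (hle hw)
          obtain ⟨t, rfl⟩ := Submodule.mem_span_singleton.1 hz
          obtain ⟨v, hv, rfl⟩ := hy
          have hw0' : w.2 = 0 := hw0
          rw [← hyz] at hw0'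
          have ht : t = 0 := by simpa [e, hat] using hw0'
          subst ht
          refine ⟨v, hv, ?_⟩
          simpa using hyz
        · rw [Submodule.map_le_iff_le_comap, vectorSpan_def, Submodule.span_le]
          rintro _ ⟨x, hx, y, hy, rfl⟩
          refine ⟨⟨hat x - hat y, sub_mem (hat_mem_hspan hx) (hat_mem_hspan hy)⟩, ?_, ?_⟩
          · simp [f, hat]
          · simp [e, hat]
      rw [← Submodule.finrank_map_subtype_eq, hmap]
      exact LinearEquiv.finrank_eq
        (Submodule.equivMapOfInjective e LinearMap.inl_injective _).symm
    rw [hr, finrank_top, Module.finrank_self, hker] at h1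
    unfold rk
    rw [← h1]; push_cast; ring


lemma exists_facet {d : ℕ} {P F : Set (Fin d → ℝ)} (hP : IsPolytope P) (hF : IsFace P F)
    {x : Fin d → ℝ} (hx : x ∈ P) (hxF : x ∉ F) :
    ∃ G, IsFace P G ∧ F ⊆ G ∧ x ∉ G ∧ rk G + 1 = rk P := by
  have hfin : {G | IsFace P G ∧ F ⊆ G ∧ x ∉ G}.Finite :=
    (faces_finite hP).subset (fun G hG => hG.1)
  obtain ⟨G, hG⟩ := hfin.exists_maximal ⟨F, hF, subset_rfl, hxF⟩
  obtain ⟨⟨hGP, hFG, hxG⟩, hmax⟩ := hG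
  refine ⟨G, hGP, hFG, hxG, ?_⟩
  have hlt : rk G < rk P := rk_lt_of_notMem hGP.subset hx (hGP.hat_notMem hx hxG)
  by_contra hne
  have hlt2 : rk G + 1 < rk P := by omega
  obtain ⟨φ, h1, h2⟩ := isFace_iff.1 hGP
  obtain ⟨S, rfl⟩ := hP
  set U : Submodule ℝ ((Fin d → ℝ) × ℝ) := hspan G ⊔ Submodule.span ℝ {hat x} with hU
  have hUr : Module.finrank ℝ U ≤ rk G + 1 := by
    refine (Submodule.finrank_add_le_finrank_add_finrank _ _).trans ?_
    have := finrank_span_singleton (K := ℝ) (v := hat x) (by simp [hat])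
    rw [this]; rfl
  have hex : ∃ s ∈ S, hat s ∉ U := by
    by_contra hall
    push Not at hall
    have hle : hspan (convexHull ℝ (S : Set (Fin d → ℝ))) ≤ U := by
      rw [hspan_conv]
      unfold hspan
      rw [Submodule.span_le]
      rintro _ ⟨s, hs, rfl⟩
      exact hall s hs
    have := Submodule.finrank_mono hle
    unfold rk at hlt2 hUr
    omega
  obtain ⟨s0, hs0, hs0U⟩ := hex
  obtain ⟨ψ0, hψ0, hψU⟩ := Submodule.exists_le_ker_of_notMem hs0U
  obtain ⟨ψ, hψs, hψU⟩ : ∃ ψ : ((Fin d → ℝ) × ℝ) →ₗ[ℝ] ℝ, ψ (hat s0) < 0 ∧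
      U ≤ LinearMap.ker ψ := by
    rcases lt_or_gt_of_ne hψ0 with h | h
    · exact ⟨ψ0, h, hψU⟩
    · refine ⟨-ψ0, by simpa using h, ?_⟩
      intro u hu
      have := hψU hu
      simp only [LinearMap.mem_ker, LinearMap.neg_apply, neg_eq_zero] at this ⊢
      exact this
  have hψG : ∀ y ∈ G, ψ (hat y) = 0 := fun y hy =>
    hψU (Submodule.mem_sup_left (hat_mem_hspan hy))
  have hψx : ψ (hat x) = 0 := hψU (Submodule.mem_sup_right (Submodule.mem_span_singleton_self _))
  obtain ⟨s1, hs1, hmin⟩ := Finset.exists_min_image (S.filter (fun s => ψ (hat s) < 0))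
    (fun s => φ (hat s) / (-ψ (hat s))) ⟨s0, by simp [hs0, hψs]⟩
  rw [Finset.mem_filter] at hs1
  set t := φ (hat s1) / (-ψ (hat s1)) with ht
  have hs1P : s1 ∈ convexHull ℝ (S : Set (Fin d → ℝ)) := subset_convexHull ℝ _ hs1.1
  have ht0 : 0 ≤ t := div_nonneg (h1 s1 hs1P) (by linarith [hs1.2])
  have hnn : ∀ s ∈ (S : Set (Fin d → ℝ)), 0 ≤ (φ + t • ψ) (hat s) := by
    intro s hs
    have hsφ := h1 s (subset_convexHull ℝ _ hs)
    simp only [LinearMap.add_apply, LinearMap.smul_apply, smul_eq_mul]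
    by_cases hneg : ψ (hat s) < 0
    · have := hmin s (Finset.mem_filter.2 ⟨hs, hneg⟩)
      rw [le_div_iff₀ (by linarith)] at this
      linarith
    · have := mul_nonneg ht0 (not_lt.1 hneg)
      linarith
  have hface := isFace_conv hnn
  rw [← (nonneg_conv hnn).2] at hface
  have hGle : G ⊆ {x ∈ convexHull ℝ (S : Set (Fin d → ℝ)) | (φ + t • ψ) (hat x) = 0} := by
    intro y hy
    refine ⟨hGP.subset hy, ?_⟩
    have := hψG y hy
    rw [h2] at hy
    simp [hy.2, this]
  have hcon := hmax ⟨hface, hFG.trans hGle, ?_⟩ hGle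
  · have hs1z : s1 ∈ G := by
      apply hcon
      refine ⟨hs1P, ?_⟩
      have : ψ (hat s1) ≠ 0 := hs1.2.ne
      simp only [LinearMap.add_apply, LinearMap.smul_apply, smul_eq_mul, ht]
      field_simp
      ring
    exact hs1.2.ne (hψG s1 hs1z)
  · rintro ⟨_, hx0⟩
    simp only [LinearMap.add_apply, LinearMap.smul_apply, hψx, smul_zero, add_zero] at hx0
    exact hxG (by rw [h2]; exact ⟨hx, hx0⟩)

/-- The vertex set. -/
def Vt {d : ℕ} (P : Set (Fin d → ℝ)) : Set (Fin d → ℝ) := {v | IsFace P {v}}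

lemma Vt_subset_gen {d : ℕ} {S : Set (Fin d → ℝ)} : Vt (convexHull ℝ S) ⊆ S := by
  intro v hv
  have h := IsFace.eq_conv hv
  by_contra hvS
  have : S ∩ {v} = ∅ := by
    ext x; simp only [Set.mem_inter_iff, Set.mem_singleton_iff, Set.mem_empty_iff_false, iff_false]
    rintro ⟨a, rfl⟩; exact hvS a
  rw [this, convexHull_empty] at h
  exact Set.singleton_ne_empty v h

lemma Vt_finite {d : ℕ} {P : Set (Fin d → ℝ)} (hP : IsPolytope P) : (Vt P).Finite := by
  obtain ⟨S, rfl⟩ := hP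
  exact S.finite_toSet.subset Vt_subset_gen

lemma Vt_subset {d : ℕ} {P : Set (Fin d → ℝ)} : Vt P ⊆ P := by
  intro v hv
  exact IsFace.subset hv rfl

lemma conv_Vt {d : ℕ} {P : Set (Fin d → ℝ)} (hP : IsPolytope P) : P = convexHull ℝ (Vt P) := by
  obtain ⟨S, hS, hmin⟩ : ∃ S : Finset (Fin d → ℝ), P = convexHull ℝ (S : Set (Fin d → ℝ)) ∧
      ∀ S' : Finset (Fin d → ℝ), P = convexHull ℝ (S' : Set (Fin d → ℝ)) → S.card ≤ S'.card := by
    have hex : ∃ n, ∃ S : Finset (Fin d → ℝ), P = convexHull ℝ (S : Set (Fin d → ℝ)) ∧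
        S.card = n := by
      obtain ⟨S, hS⟩ := hP
      exact ⟨_, S, hS, rfl⟩
    obtain ⟨S, hS, hc⟩ := Nat.find_spec hex
    refine ⟨S, hS, fun S' hS' => ?_⟩
    rw [hc]
    exact Nat.find_min' hex ⟨S', hS', rfl⟩
  apply Set.Subset.antisymm
  · nth_rewrite 1 [hS]
    apply convexHull_mono
    intro s hs
    have hsn : s ∉ convexHull ℝ ((S.erase s : Finset (Fin d → ℝ)) : Set (Fin d → ℝ)) := by
      intro hmem
      have : P = convexHull ℝ ((S.erase s : Finset (Fin d → ℝ)) : Set (Fin d → ℝ)) := by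
        rw [hS]
        apply Set.Subset.antisymm
        · apply convexHull_min _ (convex_convexHull ℝ _)
          intro t ht
          by_cases hts : t = s
          · rw [hts]; exact hmem
          · exact subset_convexHull ℝ _ (by simpa [hts] using ht)
        · exact convexHull_mono (by simp)
      have h1 := hmin _ this
      have h2 := Finset.card_erase_lt_of_mem hs
      omega
    obtain ⟨f, u, hf1, hf2⟩ := geometric_hahn_banach_point_closed (convex_convexHull ℝ _)
      (Set.Finite.isClosed_convexHull ℝ (S.erase s).finite_toSet) hsn
    show IsFace P {s}
    let φ : ((Fin d → ℝ) × ℝ) →ₗ[ℝ] ℝ :=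
      f.toLinearMap.comp (LinearMap.fst ℝ _ _) - (f s) • LinearMap.snd ℝ _ _
    have hφ : ∀ x, φ (hat x) = f x - f s := by intro x; simp [φ, hat]
    have hpos : ∀ x ∈ S, x ≠ s → 0 < φ (hat x) := by
      intro x hx hxs
      rw [hφ]
      have := hf2 x (subset_convexHull ℝ _ (by simp [hx, hxs]))
      linarith
    have hface := isFace_conv (S := (S : Set (Fin d → ℝ))) (φ := φ) (by
      intro x hx
      by_cases hxs : x = s
      · rw [hφ, hxs]; simp
      · exact (hpos x hx hxs).le)
    rw [← hS] at hface
    convert hface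
    rw [← convexHull_singleton (𝕜 := ℝ) s]
    congr 1
    ext x
    simp only [Set.mem_singleton_iff, Set.mem_ofPred_eq]
    constructor
    · rintro rfl; exact ⟨hs, by rw [hφ]; simp⟩
    · rintro ⟨a, b⟩
      by_contra hxs
      exact (hpos x a hxs).ne' b
  · apply convexHull_min Vt_subset
    rw [hS]; exact convex_convexHull ℝ _

lemma Vt_face {d : ℕ} {P F : Set (Fin d → ℝ)} (hP : IsPolytope P) (hF : IsFace P F) :
    Vt F = Vt P ∩ F := by
  ext v
  constructor
  · intro hv
    exact ⟨hF.trans hP hv, Vt_subset hv⟩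
  · rintro ⟨hv, hvF⟩
    exact IsFace.restrict (P := P) hv hF.subset (by simpa using hvF)

lemma rk_Vt {d : ℕ} {P : Set (Fin d → ℝ)} (hP : IsPolytope P) : rk (Vt P) = rk P := by
  unfold rk
  rw [← hspan_conv, ← conv_Vt hP]

lemma rk_singleton {d : ℕ} (v : Fin d → ℝ) : rk {v} = 1 := by
  unfold rk hspan
  rw [Set.image_singleton]
  exact finrank_span_singleton (by simp [hat])

lemma rk_eq_one {d : ℕ} {G : Set (Fin d → ℝ)} : rk G = 1 ↔ ∃ v, G = {v} := by
  constructor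
  · intro h
    have hne : G.Nonempty := by
      rw [Set.nonempty_iff_ne_empty]
      rintro rfl
      rw [rk_empty] at h; omega
    obtain ⟨v, hv⟩ := hne
    refine ⟨v, ?_⟩
    have hs : ({v} : Set (Fin d → ℝ)) ⊆ G := by simpa using hv
    apply Set.Subset.antisymm _ hs
    intro x hx
    have he : hspan {v} = hspan G := by
      apply Submodule.eq_of_le_of_finrank_eq (hspan_mono hs)
      have := rk_singleton v
      unfold rk at this h
      rw [this, h]
    have hx' := hat_mem_hspan hx
    rw [← he] at hx'
    unfold hspan at hx'
    rw [Set.image_singleton, Submodule.mem_span_singleton] at hx'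
    obtain ⟨t, ht⟩ := hx'
    simp only [hat, Prod.smul_mk, smul_eq_mul, mul_one, Prod.mk.injEq] at ht
    obtain ⟨h1, h2⟩ := ht
    rw [h2, one_smul] at h1
    exact h1.symm
  · rintro ⟨v, rfl⟩; exact rk_singleton v

lemma rk_eq_zero {d : ℕ} {G : Set (Fin d → ℝ)} : rk G = 0 ↔ G = ∅ := by
  constructor
  · intro h
    by_contra hne
    obtain ⟨v, hv⟩ := Set.nonempty_iff_ne_empty.2 hne
    have := rk_mono (X := {v}) (Y := G) (by simpa using hv)
    rw [rk_singleton] at this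
    omega
  · rintro rfl; exact rk_empty

lemma ncard_Vt {d : ℕ} (P : Set (Fin d → ℝ)) :
    (Vt P).ncard = {G | IsFace P G ∧ rk G = 1}.ncard := by
  apply Set.ncard_congr (fun v _ => {v})
  · intro v hv; exact ⟨hv, rk_singleton v⟩
  · intro v w _ _ h; simpa using h
  · rintro G ⟨hG, hr⟩
    obtain ⟨v, rfl⟩ := rk_eq_one.1 hr
    exact ⟨v, hG, rfl⟩

lemma finrank_AffDep {d : ℕ} {V : Set (Fin d → ℝ)} (hV : V.Finite) :
    Module.finrank ℝ (AffDep V) + rk V = V.ncard ∧ FiniteDimensional ℝ (AffDep V) := by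
  have : Fintype V := hV.fintype
  let f : (V → ℝ) →ₗ[ℝ] ((Fin d → ℝ) × ℝ) := Fintype.linearCombination ℝ (fun v : V => hat v.1)
  have hf : ∀ a : V → ℝ, f a = (∑ v : V, a v • v.1, ∑ v : V, a v) := by
    intro a
    simp only [f, Fintype.linearCombination_apply, hat]
    ext <;> simp [Prod.fst_sum, Prod.snd_sum]
  have hsum : ∀ {M : Type} [AddCommMonoid M] (b : (Fin d → ℝ) → M),
      Function.support b ⊆ V → (∑ᶠ v, b v) = ∑ v : V, b v.1 := by
    intro M _ b hb
    rw [finsum_eq_sum_of_support_subset (s := hV.toFinset) b (by simpa using hb)]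
    rw [← Finset.sum_coe_sort]
    apply Fintype.sum_equiv (Equiv.subtypeEquivRight (by simp))
    intro x; rfl
  have hsm : ∀ a : (Fin d → ℝ) → ℝ, Function.support a ⊆ V →
      Function.support (fun v => a v • v) ⊆ V := by
    intro a ha v hv
    apply ha
    intro h0
    exact hv (by simp [h0])
  let ext0 : (V → ℝ) → ((Fin d → ℝ) → ℝ) := fun a v => if h : v ∈ V then a ⟨v, h⟩ else 0
  have hextV : ∀ a (v : V), ext0 a v.1 = a v := by
    intro a v; simp [ext0]
  have hexts : ∀ a, Function.support (ext0 a) ⊆ V := by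
    intro a v hv
    by_contra hn
    exact hv (by simp [ext0, hn])
  let e : AffDep V ≃ₗ[ℝ] LinearMap.ker f :=
    { toFun := fun a => ⟨fun v => a.1 v.1, by
        obtain ⟨a, h1, h2, h3, h4⟩ := a
        rw [LinearMap.mem_ker, hf]
        rw [hsum _ h2] at h3
        rw [hsum _ (hsm a h2)] at h4
        simp only
        rw [h3, h4]; rfl⟩
      map_add' := fun a b => rfl
      map_smul' := fun a b => rfl
      invFun := fun a => ⟨ext0 a.1, by
        obtain ⟨a, ha⟩ := a
        rw [LinearMap.mem_ker, hf, Prod.mk_eq_zero] at ha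
        refine ⟨hV.subset (hexts a), hexts a, ?_, ?_⟩
        · rw [hsum _ (hexts a)]
          simp only [hextV]
          exact ha.2
        · rw [hsum _ (hsm _ (hexts a))]
          simp only [hextV]
          exact ha.1⟩
      left_inv := by
        rintro ⟨a, h1, h2, h3, h4⟩
        ext v
        simp only [ext0]
        split_ifs with h
        · rfl
        · by_contra hne
          exact h (h2 (fun h0 => hne h0.symm))
      right_inv := by
        rintro ⟨a, ha⟩
        ext v
        simp [hextV] }
  refine ⟨?_, Module.Finite.equiv e.symm⟩
  rw [e.finrank_eq]
  have h1 := LinearMap.finrank_range_add_finrank_ker f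
  rw [Module.finrank_fintype_fun_eq_card] at h1
  have h2 : LinearMap.range f = hspan V := by
    simp only [f]
    rw [Fintype.range_linearCombination]
    unfold hspan
    congr 1
    ext w; simp [Set.mem_image]
  rw [h2] at h1
  rw [← Nat.card_coe_set_eq, Nat.card_eq_fintype_card, ← h1, add_comm]
  rfl


section cells

variable {W : Type*} [AddCommGroup W] [Module ℝ W]

/-- Relatively open polyhedral cone of functionals. -/
def opencone (A B : Set W) : Set (W →ₗ[ℝ] ℝ) :=
  {φ | (∀ a ∈ A, φ a = 0) ∧ ∀ b ∈ B, 0 < φ b}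

/-- Sign vector of a functional along a finite set. -/
def sgv (J : Finset W) (φ : W →ₗ[ℝ] ℝ) : J → SignType := fun u => SignType.sign (φ u.1)

/-- Weight of a sign vector. -/
def wgt (J : Finset W) (σ : J → SignType) : ℤ :=
  (-1) ^ Module.finrank ℝ (Submodule.span ℝ {u : W | ∃ h : u ∈ J, σ ⟨u, h⟩ = 0})

lemma mem_span_of_zero {A B : Set W} (hB : B.Finite) {φ : W →ₗ[ℝ] ℝ} (hφ : φ ∈ opencone A B)
    {u : W} (hu : ∀ χ ∈ opencone A B, χ u = 0) : u ∈ Submodule.span ℝ A := by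
  by_contra hn
  obtain ⟨ψ, hψ, hle⟩ := Submodule.exists_le_ker_of_notMem hn
  have hψA : ∀ a ∈ A, ψ a = 0 := fun a ha => hle (Submodule.subset_span ha)
  have : ∃ ε : ℝ, 0 < ε ∧ ∀ b ∈ B, 0 < φ b + ε * ψ b := by
    have h1 : ∀ b ∈ B, ∀ᶠ ε : ℝ in nhdsWithin 0 (Set.Ioi 0), 0 < φ b + ε * ψ b := by
      intro b hb
      have hc : Filter.Tendsto (fun ε : ℝ => φ b + ε * ψ b) (nhdsWithin 0 (Set.Ioi 0))
          (nhds (φ b + 0 * ψ b)) := by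
        apply Filter.Tendsto.mono_left _ nhdsWithin_le_nhds
        exact Continuous.tendsto (by fun_prop) 0
      exact hc.eventually_const_lt (by simpa using hφ.2 b hb)
    have h2 := (Filter.eventually_all_finite hB).2 h1
    obtain ⟨ε, hε, hε0⟩ := (h2.and self_mem_nhdsWithin).exists
    exact ⟨ε, hε0, hε⟩
  obtain ⟨ε, hε, hB'⟩ := this
  have := hu (φ + ε • ψ) ⟨fun a ha => by simp [hφ.1 a ha, hψA a ha], fun b hb => by
    simpa using hB' b hb⟩
  rw [LinearMap.add_apply, hu φ hφ, LinearMap.smul_apply, zero_add, smul_eq_mul] at this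
  rcases mul_eq_zero.1 this with h | h
  · exact hε.ne' h
  · exact hψ h

lemma finrank_span_insert' [FiniteDimensional ℝ W] {A : Set W} {u : W}
    (hus : u ∉ Submodule.span ℝ A) :
    Module.finrank ℝ (Submodule.span ℝ (insert u A)) =
      Module.finrank ℝ (Submodule.span ℝ A) + 1 := by
  rw [Submodule.span_insert, sup_comm]
  have := Submodule.finrank_sup_add_finrank_inf_eq (Submodule.span ℝ A) (Submodule.span ℝ {u})
  have hu0 : u ≠ 0 := by rintro rfl; exact hus (zero_mem _)
  have hinf : Submodule.span ℝ A ⊓ Submodule.span ℝ {u} = ⊥ := by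
    rw [← disjoint_iff, Submodule.disjoint_span_singleton' hu0]
    exact hus
  rw [hinf, finrank_bot, finrank_span_singleton hu0] at this
  omega

lemma cell_sum [FiniteDimensional ℝ W] (J : Finset W) : ∀ (n : ℕ) (A B : Set W), A ⊆ J → B.Finite →
    (opencone A B).Nonempty →
    {u | u ∈ J ∧ ¬ ∃ s, ∀ φ ∈ opencone A B, SignType.sign (φ u) = s}.ncard = n →
    ∑ᶠ σ ∈ sgv J '' opencone A B, wgt J σ = (-1) ^ Module.finrank ℝ (Submodule.span ℝ A) := by
  intro n
  induction n using Nat.strong_induction_on with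
  | _ n ih =>
  intro A B hAJ hB hne hcard
  have hUfin : {u | u ∈ J ∧ ¬ ∃ s, ∀ φ ∈ opencone A B, SignType.sign (φ u) = s}.Finite :=
    J.finite_toSet.subset (fun u hu => hu.1)
  by_cases hdec : ∀ u ∈ J, ∃ s, ∀ φ ∈ opencone A B, SignType.sign (φ u) = s
  · obtain ⟨φ, hφ⟩ := hne
    have him : sgv J '' opencone A B = {sgv J φ} := by
      ext σ
      simp only [Set.mem_image, Set.mem_singleton_iff]
      constructor
      · rintro ⟨χ, hχ, rfl⟩
        funext u
        obtain ⟨s, hs⟩ := hdec u.1 u.2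
        simp only [sgv]
        rw [hs χ hχ, hs φ hφ]
      · rintro rfl; exact ⟨φ, hφ, rfl⟩
    rw [him, finsum_mem_singleton]
    unfold wgt
    have : Submodule.span ℝ {u : W | ∃ h : u ∈ J, sgv J φ ⟨u, h⟩ = 0} = Submodule.span ℝ A := by
      apply le_antisymm
      · rw [Submodule.span_le]
        rintro u ⟨hu, h0⟩
        apply mem_span_of_zero hB hφ
        intro χ hχ
        obtain ⟨s, hs⟩ := hdec u hu
        have h0' : SignType.sign (φ u) = 0 := h0
        rw [hs φ hφ] at h0'
        have := hs χ hχ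
        rw [h0', sign_eq_zero_iff] at this
        exact this
      · apply Submodule.span_mono
        intro a ha
        exact ⟨hAJ ha, by simp [sgv, hφ.1 a ha]⟩
    rw [this]
  · push Not at hdec
    obtain ⟨u, huJ, hu⟩ := hdec
    have hpos : opencone A (insert u B) = {φ ∈ opencone A B | 0 < φ u} := by
      ext φ; simp only [opencone, Set.mem_ofPred_eq, Set.mem_insert_iff, forall_eq_or_imp]; tauto
    have hneg : opencone A (insert (-u) B) = {φ ∈ opencone A B | φ u < 0} := by
      ext φ; simp only [opencone, Set.mem_ofPred_eq, Set.mem_insert_iff, forall_eq_or_imp, map_neg,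
        Left.neg_pos_iff]; tauto
    have hzero : opencone (insert u A) B = {φ ∈ opencone A B | φ u = 0} := by
      ext φ; simp only [opencone, Set.mem_ofPred_eq, Set.mem_insert_iff, forall_eq_or_imp]; tauto
    -- convexity
    have hzne_of : ∀ φ ∈ opencone A B, ∀ χ ∈ opencone A B, 0 < φ u → χ u < 0 →
        (opencone (insert u A) B).Nonempty := by
      intro φ hφ χ hχ h1 h2
      refine ⟨(-χ u) • φ + (φ u) • χ, ?_⟩
      rw [hzero]
      refine ⟨⟨fun a ha => by simp [hφ.1 a ha, hχ.1 a ha], fun b hb => ?_⟩, ?_⟩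
      · have := mul_pos (neg_pos.2 h2) (hφ.2 b hb)
        have := mul_pos h1 (hχ.2 b hb)
        simp only [LinearMap.add_apply, LinearMap.smul_apply, smul_eq_mul]
        linarith
      · simp only [LinearMap.add_apply, LinearMap.smul_apply, smul_eq_mul]; ring
    have hus : u ∉ Submodule.span ℝ A := by
      intro hm
      obtain ⟨χ, hχ, hs⟩ := hu 0
      apply hs
      have hle : Submodule.span ℝ A ≤ LinearMap.ker χ := by
        rw [Submodule.span_le]; exact hχ.1
      rw [sign_eq_zero_iff]; exact hle hm
    -- all pieces nonempty
    have hzne : (opencone (insert u A) B).Nonempty := by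
      by_contra hz
      have hnz : ∀ φ ∈ opencone A B, φ u ≠ 0 := by
        intro φ hφ h0
        exact hz ⟨φ, by rw [hzero]; exact ⟨hφ, h0⟩⟩
      obtain ⟨χ, hχ, hs⟩ := hu 1
      obtain ⟨χ', hχ', hs'⟩ := hu (-1)
      have h1 : χ u < 0 := by
        rcases lt_trichotomy (χ u) 0 with h | h | h
        · exact h
        · exact absurd h (hnz χ hχ)
        · exact absurd (sign_pos h) hs
      have h2 : 0 < χ' u := by
        rcases lt_trichotomy (χ' u) 0 with h | h | h
        · exact absurd (sign_neg h) hs'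
        · exact absurd h (hnz χ' hχ')
        · exact h
      exact hz (hzne_of χ' hχ' χ hχ h2 h1)
    obtain ⟨φ0, hφ0⟩ := hzne
    have hφ0' : φ0 ∈ opencone A B := by rw [hzero] at hφ0; exact hφ0.1
    have hpm : (opencone A (insert u B)).Nonempty ∧ (opencone A (insert (-u) B)).Nonempty := by
      have h00 : φ0 u = 0 := by rw [hzero] at hφ0; exact hφ0.2
      -- perturb within the cone
      have aux : ∀ v : W, v ∉ Submodule.span ℝ A → φ0 v = 0 →
          (opencone A (insert v B)).Nonempty := by
        intro v hv hv0
        by_contra hno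
        -- otherwise the functional values on v are nonpositive
        have hnp : ∀ χ ∈ opencone A B, χ v ≤ 0 := by
          intro χ hχ
          by_contra hp
          apply hno
          refine ⟨χ, hχ.1, ?_⟩
          rintro b (rfl | hb)
          · exact not_le.1 hp
          · exact hχ.2 b hb
        obtain ⟨ψ, hψ, hle⟩ := Submodule.exists_le_ker_of_notMem hv
        -- shift so as to use `mem_span_of_zero`
        apply hv
        apply mem_span_of_zero hB hφ0'
        intro χ hχ
        apply le_antisymm (hnp χ hχ)
        have hB' : ∃ ε : ℝ, 0 < ε ∧ ∀ b ∈ B, 0 < φ0 b - ε * χ b := by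
          have h1 : ∀ b ∈ B, ∀ᶠ ε : ℝ in nhdsWithin 0 (Set.Ioi 0), 0 < φ0 b - ε * χ b := by
            intro b hb
            have hc : Filter.Tendsto (fun ε : ℝ => φ0 b - ε * χ b) (nhdsWithin 0 (Set.Ioi 0))
                (nhds (φ0 b - 0 * χ b)) := by
              apply Filter.Tendsto.mono_left _ nhdsWithin_le_nhds
              exact Continuous.tendsto (by fun_prop) 0
            exact hc.eventually_const_lt (by simpa using hφ0'.2 b hb)
          have h2 := (Filter.eventually_all_finite hB).2 h1
          obtain ⟨ε, hε, hε0⟩ := (h2.and self_mem_nhdsWithin).exists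
          exact ⟨ε, hε0, hε⟩
        obtain ⟨ε, hε, hB'⟩ := hB'
        have := hnp (φ0 - ε • χ) ⟨fun a ha => by simp [hφ0'.1 a ha, hχ.1 a ha], fun b hb => by
          simpa using hB' b hb⟩
        rw [LinearMap.sub_apply, hv0, LinearMap.smul_apply, zero_sub, smul_eq_mul] at this
        by_contra hc
        have := mul_neg_of_pos_of_neg hε (not_le.1 hc)
        linarith
      exact ⟨aux u hus h00, aux (-u) (by rwa [Submodule.neg_mem_iff]) (by simp [h00])⟩
    -- measure decreases
    have hdecr : ∀ A' B' : Set W, opencone A' B' ⊆ opencone A B →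
        (∃ s, ∀ φ ∈ opencone A' B', SignType.sign (φ u) = s) →
        {v | v ∈ J ∧ ¬ ∃ s, ∀ φ ∈ opencone A' B', SignType.sign (φ v) = s}.ncard < n := by
      intro A' B' hsub hs
      rw [← hcard]
      apply Set.ncard_lt_ncard _ hUfin
      refine ⟨?_, fun hle => ?_⟩
      · rintro v ⟨hv, hv'⟩
        refine ⟨hv, fun ⟨s, hs⟩ => hv' ⟨s, fun φ hφ => hs φ (hsub hφ)⟩⟩
      · have : u ∈ {v | v ∈ J ∧ ¬ ∃ s, ∀ φ ∈ opencone A B, SignType.sign (φ v) = s} := by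
          refine ⟨huJ, ?_⟩
          push Not
          exact hu
        exact (hle this).2 hs
    have ePos := ih _ (hdecr A (insert u B) (by rw [hpos]; exact fun φ h => h.1)
      ⟨1, by rw [hpos]; exact fun φ h => sign_pos h.2⟩) A (insert u B) hAJ (hB.insert u) hpm.1 rfl
    have eNeg := ih _ (hdecr A (insert (-u) B) (by rw [hneg]; exact fun φ h => h.1)
      ⟨-1, by rw [hneg]; exact fun φ h => sign_neg h.2⟩) A (insert (-u) B) hAJ (hB.insert _)
      hpm.2 rfl
    have eZero := ih _ (hdecr (insert u A) B (by rw [hzero]; exact fun φ h => h.1)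
      ⟨0, by rw [hzero]; exact fun φ h => by rw [h.2]; simp⟩) (insert u A) B
      (Set.insert_subset huJ hAJ) hB ⟨φ0, hφ0⟩ rfl
    have hfr : Module.finrank ℝ (Submodule.span ℝ (insert u A)) =
        Module.finrank ℝ (Submodule.span ℝ A) + 1 :=
      finrank_span_insert' hus
    have hun : sgv J '' opencone A B = (sgv J '' opencone A (insert u B)) ∪
        ((sgv J '' opencone A (insert (-u) B)) ∪ (sgv J '' opencone (insert u A) B)) := by
      rw [← Set.image_union, ← Set.image_union, hpos, hneg, hzero]
      congr 1
      ext φ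
      simp only [Set.mem_union, Set.mem_ofPred_eq]
      have := lt_trichotomy (φ u) 0
      tauto
    have dis : ∀ {X Y : Set (W →ₗ[ℝ] ℝ)}, (∀ φ ∈ X, ∀ χ ∈ Y,
        SignType.sign (φ u) ≠ SignType.sign (χ u)) → Disjoint (sgv J '' X) (sgv J '' Y) := by
      intro X Y h
      rw [Set.disjoint_left]
      rintro _ ⟨φ, hφ, rfl⟩ ⟨χ, hχ, he⟩
      exact h φ hφ χ hχ (congrFun he ⟨u, huJ⟩).symm
    rw [hun, finsum_mem_union _ (Set.toFinite _) (Set.toFinite _),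
      finsum_mem_union _ (Set.toFinite _) (Set.toFinite _), ePos, eNeg, eZero, hfr]
    · ring
    · apply dis
      rw [hneg, hzero]
      rintro φ ⟨_, h1⟩ χ ⟨_, h2⟩
      rw [sign_neg h1, h2]; simp
    · rw [← Set.image_union]
      apply dis
      rw [hpos, hneg, hzero]
      rintro φ ⟨_, h1⟩ χ (⟨_, h2⟩ | ⟨_, h2⟩)
      · rw [sign_pos h1, sign_neg h2]; decide
      · rw [sign_pos h1, h2]; simp

end cells


lemma opencone_of_sgv {W : Type*} [AddCommGroup W] [Module ℝ W] {J : Finset W} {A B : Set W}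
    (hA : A ⊆ J) (hB : B ⊆ J) {φ χ : W →ₗ[ℝ] ℝ} (hφ : φ ∈ opencone A B)
    (h : sgv J φ = sgv J χ) : χ ∈ opencone A B := by
  constructor
  · intro a ha
    have : SignType.sign (φ a) = SignType.sign (χ a) := congrFun h ⟨a, hA ha⟩
    rw [hφ.1 a ha, sign_zero] at this
    exact sign_eq_zero_iff.1 this.symm
  · intro b hb
    have : SignType.sign (φ b) = SignType.sign (χ b) := congrFun h ⟨b, hB hb⟩
    rw [sign_pos (hφ.2 b hb)] at this
    exact sign_eq_one_iff.1 this.symm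

theorem euler {d : ℕ} {P F : Set (Fin d → ℝ)} (hP : IsPolytope P) (hF : IsFace P F)
    (hne : F ≠ P) : ∑ᶠ G ∈ {G | IsFace P G ∧ F ⊆ G}, (-1 : ℤ) ^ (rk G) = 0 := by
  have hfin := faces_finite hP
  obtain ⟨φ0, h1, h2⟩ := isFace_iff.1 hF
  obtain ⟨S, rfl⟩ := hP
  set P := convexHull ℝ (S : Set (Fin d → ℝ)) with hPdef
  have hSP : ∀ s ∈ S, s ∈ P := fun s hs => subset_convexHull ℝ _ hs
  set c : (Fin d → ℝ) → ℝ := fun s => φ0 (hat s) with hc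
  have hcF : ∀ s ∈ S, s ∈ F → c s = 0 := by
    intro s _ hs; rw [h2] at hs; exact hs.2
  have hcp : ∀ s ∈ S, s ∉ F → 0 < c s := by
    intro s hs hsF
    refine lt_of_le_of_ne (h1 s (hSP s hs)) (fun h0 => hsF ?_)
    rw [h2]; exact ⟨hSP s hs, h0.symm⟩
  have hc0 : ∀ s ∈ S, 0 ≤ c s := fun s hs => h1 s (hSP s hs)
  let u : (Fin d → ℝ) → (Fin d → ℝ) → (Fin d → ℝ) × ℝ := fun s t => c t • hat s - c s • hat t
  have hu : ∀ (φ : ((Fin d → ℝ) × ℝ) →ₗ[ℝ] ℝ) s t,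
      φ (u s t) = c t * φ (hat s) - c s * φ (hat t) := by intro φ s t; simp [u]
  let J : Finset ((Fin d → ℝ) × ℝ) := S.image hat ∪ Finset.image₂ u S S
  let A0 : Set ((Fin d → ℝ) × ℝ) := hat '' ((S : Set (Fin d → ℝ)) ∩ F)
  let AG : Set (Fin d → ℝ) → Set ((Fin d → ℝ) × ℝ) := fun G =>
    A0 ∪ {w | ∃ s ∈ S, s ∈ G ∧ ∃ t ∈ S, t ∈ G ∧ u s t = w}
  let BG : Set (Fin d → ℝ) → Set ((Fin d → ℝ) × ℝ) := fun G =>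
    {w | ∃ s ∈ S, s ∉ G ∧ ∃ t ∈ S, (t ∈ G ∧ t ∉ F) ∧ u s t = w}
  have huJ : ∀ s ∈ S, ∀ t ∈ S, u s t ∈ (J : Set _) := by
    intro s hs t ht
    simp only [J, Finset.coe_union, Finset.coe_image, Finset.coe_image₂]
    exact Or.inr ⟨s, hs, t, ht, rfl⟩
  have hA0J : A0 ⊆ (J : Set _) := by
    rintro _ ⟨s, hs, rfl⟩
    simp only [J, Finset.coe_union, Finset.coe_image, Finset.coe_image₂]
    exact Or.inl ⟨s, hs.1, rfl⟩
  have hAJ : ∀ G, AG G ⊆ (J : Set _) := by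
    rintro G w (hw | ⟨s, hs, _, t, ht, _, rfl⟩)
    · exact hA0J hw
    · exact huJ s hs t ht
  have hBJ : ∀ G, BG G ⊆ (J : Set _) := by
    rintro G w ⟨s, hs, _, t, ht, _, rfl⟩
    exact huJ s hs t ht
  have hspanA0 : Submodule.span ℝ A0 = hspan F := by
    rw [hF.eq_conv, hspan_conv]
    rfl
  -- total
  have htot := cell_sum J _ A0 ∅ hA0J Set.finite_empty ⟨0, by simp [opencone]⟩ rfl
  rw [hspanA0] at htot
  set I : Set (Set (Fin d → ℝ)) := {G | IsFace P G ∧ F ⊆ G ∧ G ≠ F} with hI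
  have hIfin : I.Finite := hfin.subset (fun G hG => hG.1)
  -- a generator in G outside F
  have hgen : ∀ G, IsFace P G → ¬ G ⊆ F → ∃ t ∈ S, t ∈ G ∧ t ∉ F := by
    intro G hG hn
    by_contra hall
    push Not at hall
    apply hn
    rw [hG.eq_conv, hF.eq_conv]
    apply convexHull_mono
    rintro s ⟨a, b⟩
    exact ⟨a, hall s a b⟩
  have hgenI : ∀ G ∈ I, ∃ t ∈ S, t ∈ G ∧ t ∉ F := fun G hG =>
    hgen G hG.1 (fun h => hG.2.2 (h.antisymm hG.2.1))
  -- each piece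
  have hpiece : ∀ G ∈ I, ∑ᶠ σ ∈ sgv J '' opencone (AG G) (BG G), wgt J σ =
      - (-1 : ℤ) ^ rk G := by
    intro G hG
    obtain ⟨t0, ht0, ht0G, ht0F⟩ := hgenI G hG
    have hnonempty : (opencone (AG G) (BG G)).Nonempty := by
      obtain ⟨φ, h3, h4⟩ := isFace_iff.1 hG.1
      have hz : ∀ s ∈ G, φ (hat s) = 0 := by rw [h4]; exact fun s hs => hs.2
      refine ⟨φ, ?_, ?_⟩
      · rintro _ (⟨s, hs, rfl⟩ | ⟨s, hs, hsG, t, ht, htG, rfl⟩)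
        · exact hz s (hG.2.1 hs.2)
        · rw [hu, hz s hsG, hz t htG]; simp
      · rintro _ ⟨s, hs, hsG, t, ht, ⟨htG, htF⟩, rfl⟩
        rw [hu, hz t htG, mul_zero, sub_zero]
        refine mul_pos (hcp t ht htF) (lt_of_le_of_ne (h3 s (hSP s hs)) (fun h0 => hsG ?_))
        rw [h4]; exact ⟨hSP s hs, h0.symm⟩
    rw [cell_sum J _ (AG G) (BG G) (hAJ G) (J.finite_toSet.subset (hBJ G)) hnonempty rfl]
    have hnot : hat t0 ∉ Submodule.span ℝ (AG G) := by
      intro hm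
      have hle : Submodule.span ℝ (AG G) ≤ LinearMap.ker φ0 := by
        rw [Submodule.span_le]
        rintro _ (⟨s, hs, rfl⟩ | ⟨s, hs, hsG, t, ht, htG, rfl⟩)
        · exact hcF s hs.1 hs.2
        · show φ0 (u s t) = 0
          rw [hu]; simp only [hc]; ring
      exact (hcp t0 ht0 ht0F).ne' (hle hm)
    have hins := finrank_span_insert' hnot
    have hspanG : Submodule.span ℝ (insert (hat t0) (AG G)) = hspan G := by
      apply le_antisymm
      · rw [Submodule.span_le]
        rintro _ (rfl | ⟨s, hs, rfl⟩ | ⟨s, hs, hsG, t, ht, htG, rfl⟩)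
        · exact hat_mem_hspan ht0G
        · exact hat_mem_hspan (hG.2.1 hs.2)
        · exact sub_mem (Submodule.smul_mem _ _ (hat_mem_hspan hsG))
            (Submodule.smul_mem _ _ (hat_mem_hspan htG))
      · have hle : hspan G = hspan ((S : Set (Fin d → ℝ)) ∩ G) := by
          rw [← hspan_conv ((S : Set (Fin d → ℝ)) ∩ G), ← hG.1.eq_conv]
        rw [hle]
        unfold hspan
        rw [Submodule.span_le]
        rintro _ ⟨s, ⟨hs, hsG⟩, rfl⟩
        have hct := hcp t0 ht0 ht0F
        have he : hat s = (c t0)⁻¹ • (u s t0 + c s • hat t0) := by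
          simp only [u, sub_add_cancel, smul_smul]
          rw [inv_mul_cancel₀ hct.ne', one_smul]
        rw [he]
        apply Submodule.smul_mem
        apply add_mem
        · exact Submodule.subset_span (Or.inr (Or.inr ⟨s, hs, hsG, t0, ht0, ht0G, rfl⟩))
        · exact Submodule.smul_mem _ _ (Submodule.subset_span (Or.inl rfl))
    rw [hspanG] at hins
    unfold rk
    rw [hins, pow_succ]; ring
  -- decomposition
  have hdecomp : opencone A0 ∅ = ⋃ G ∈ I, opencone (AG G) (BG G) := by
    apply Set.Subset.antisymm
    · intro φ hφ
      have hφF : ∀ s ∈ S, s ∈ F → φ (hat s) = 0 := fun s hs hsF => hφ.1 _ ⟨s, ⟨hs, hsF⟩, rfl⟩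
      obtain ⟨t0, ht0, _, ht0F⟩ := hgen P (isFace_self P) (fun h => hne (hF.subset.antisymm h))
      obtain ⟨t, ht, hmin⟩ := Finset.exists_min_image (S.filter (fun s => s ∉ F))
        (fun s => φ (hat s) / c s) ⟨t0, by simp [ht0, ht0F]⟩
      rw [Finset.mem_filter] at ht
      set m := φ (hat t) / c t with hm
      have hct := hcp t ht.1 ht.2
      have hval : ∀ s, (φ - m • φ0) (hat s) = φ (hat s) - m * c s := by intro s; simp [hc]
      have hnn : ∀ s ∈ (S : Set (Fin d → ℝ)), 0 ≤ (φ - m • φ0) (hat s) := by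
        intro s hs
        rw [hval]
        by_cases hsF : s ∈ F
        · rw [hφF s hs hsF, hcF s hs hsF]; simp
        · have := hmin s (Finset.mem_filter.2 ⟨hs, hsF⟩)
          rw [le_div_iff₀ (hcp s hs hsF)] at this
          linarith
      set G := {x ∈ P | (φ - m • φ0) (hat x) = 0} with hGdef
      have hG : IsFace P G := isFace_iff.2 ⟨φ - m • φ0, (nonneg_conv hnn).1, rfl⟩
      have hFG : F ⊆ G := by
        rw [hF.eq_conv, hG.eq_conv]
        apply convexHull_mono
        rintro s ⟨hs, hsF⟩
        refine ⟨hs, hSP s hs, ?_⟩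
        rw [hval, hφF s hs hsF, hcF s hs hsF]; simp
      have htG : t ∈ G := by
        refine ⟨hSP t ht.1, ?_⟩
        rw [hval, hm]; field_simp; ring
      have hGv : ∀ s ∈ G, φ (hat s) = m * c s := by
        intro s hs
        have := hs.2
        rw [hval] at this; linarith
      simp only [Set.mem_iUnion]
      refine ⟨G, ⟨hG, hFG, fun h => ht.2 (h ▸ htG)⟩, ?_, ?_⟩
      · rintro _ (hw | ⟨s, hs, hsG, t, ht, htG, rfl⟩)
        · exact hφ.1 _ hw
        · rw [hu, hGv s hsG, hGv t htG]; ring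
      · rintro _ ⟨s, hs, hsG, t, ht, ⟨htG, htF⟩, rfl⟩
        rw [hu, hGv t htG]
        have hlt : 0 < φ (hat s) - m * c s := by
          rw [← hval]
          refine lt_of_le_of_ne (hnn s hs) (fun h0 => hsG ⟨hSP s hs, h0.symm⟩)
        have := mul_pos (hcp t ht htF) hlt
        linarith
    · intro φ hφ
      simp only [Set.mem_iUnion] at hφ
      obtain ⟨G, hG, hφ⟩ := hφ
      exact ⟨fun a ha => hφ.1 a (Or.inl ha), by simp⟩
  -- uniqueness
  have huniq : ∀ G ∈ I, ∀ G' ∈ I, ∀ φ ∈ opencone (AG G) (BG G), φ ∈ opencone (AG G') (BG G') →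
      G ⊆ G' := by
    intro G hG G' hG' φ hφ hφ'
    rw [hG.1.eq_conv, hG'.1.eq_conv]
    apply convexHull_mono
    rintro s ⟨hs, hsG⟩
    refine ⟨hs, ?_⟩
    by_contra hsG'
    have hsF : s ∉ F := fun h => hsG' (hG'.2.1 h)
    obtain ⟨t, ht, htG', htF⟩ := hgenI G' hG'
    have e1 := hφ'.2 _ ⟨s, hs, hsG', t, ht, ⟨htG', htF⟩, rfl⟩
    rw [hu] at e1
    by_cases htG : t ∈ G
    · have e2 := hφ.1 _ (Or.inr ⟨s, hs, hsG, t, ht, htG, rfl⟩)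
      rw [hu] at e2
      linarith
    · have e2 := hφ.2 _ ⟨t, ht, htG, s, hs, ⟨hsG, hsF⟩, rfl⟩
      rw [hu] at e2
      linarith
  have hdisj : I.PairwiseDisjoint (fun G => sgv J '' opencone (AG G) (BG G)) := by
    intro G hG G' hG' hGG'
    simp only [Function.onFun]
    rw [Set.disjoint_left]
    rintro _ ⟨φ, hφ, rfl⟩ ⟨χ, hχ, he⟩
    have hφ' := opencone_of_sgv (hAJ G') (hBJ G') hχ he
    exact hGG' ((huniq G hG G' hG' φ hφ hφ').antisymm (huniq G' hG' G hG φ hφ' hφ))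
  rw [hdecomp, Set.image_iUnion₂, finsum_mem_biUnion hdisj hIfin (fun _ _ => Set.toFinite _),
    finsum_mem_congr rfl hpiece] at htot
  have hsplit : {G | IsFace P G ∧ F ⊆ G} = insert F I := by
    ext G
    simp only [hI, Set.mem_insert_iff, Set.mem_ofPred_eq]
    constructor
    · rintro ⟨a, b⟩
      by_cases h : G = F
      · exact Or.inl h
      · exact Or.inr ⟨a, b, h⟩
    · rintro (rfl | ⟨a, b, _⟩)
      · exact ⟨hF, subset_rfl⟩
      · exact ⟨a, b⟩
  rw [hsplit, finsum_mem_insert _ (by simp [hI]) hIfin]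
  rw [finsum_mem_neg_distrib _ hIfin] at htot
  have : (-1 : ℤ) ^ rk F = (-1 : ℤ) ^ Module.finrank ℝ (hspan F) := rfl
  rw [this, ← htot]
  ring


lemma finrank_map_of_ker_le {V V' : Type*} [AddCommGroup V] [Module ℝ V] [AddCommGroup V']
    [Module ℝ V'] [FiniteDimensional ℝ V] (f : V →ₗ[ℝ] V') (U : Submodule ℝ V)
    (h : LinearMap.ker f ≤ U) :
    Module.finrank ℝ (U.map f) + Module.finrank ℝ (LinearMap.ker f) = Module.finrank ℝ U := by
  have h1 := LinearMap.finrank_range_add_finrank_ker (f.domRestrict U)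
  rw [LinearMap.range_domRestrict, LinearMap.ker_domRestrict] at h1
  rw [← h1, (Submodule.comapSubtypeEquivOfLe h).finrank_eq]

lemma exists_quotient {d : ℕ} {P F : Set (Fin d → ℝ)} (hP : IsPolytope P) (hF : IsFace P F) :
    ∃ Q ψ, IsQuotientPair P F Q ψ ∧ ∀ G, IsFace P G → F ⊆ G → rk (ψ G) + rk F = rk G := by
  by_cases hemp : F = ∅
  · subst hemp
    refine ⟨P, id, ⟨hP, ?_, ?_⟩, ?_⟩
    · have : {G : Set (Fin d → ℝ) | IsFace P G ∧ ∅ ⊆ G} = {G | IsFace P G} := by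
        ext G; simp
      rw [this]
      exact Set.bijOn_id _
    · intro _ _ _ _; rfl
    · intro G _ _; rw [rk_empty]; rfl
  have hrk : 1 ≤ rk F := by
    by_contra h
    exact hemp (rk_eq_zero.1 (by omega))
  obtain ⟨φ0, h1, h2⟩ := isFace_iff.1 hF
  obtain ⟨S, rfl⟩ := hP
  set P := convexHull ℝ (S : Set (Fin d → ℝ)) with hPdef
  have hSP : ∀ s ∈ S, s ∈ P := fun s hs => subset_convexHull ℝ _ hs
  have hzF : ∀ s ∈ F, φ0 (hat s) = 0 := by
    intro s hs; rw [h2] at hs; exact hs.2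
  have hcp : ∀ s ∈ S, s ∉ F → 0 < φ0 (hat s) := by
    intro s hs hsF
    refine lt_of_le_of_ne (h1 s (hSP s hs)) (fun h0 => hsF ?_)
    rw [h2]; exact ⟨hSP s hs, h0.symm⟩
  -- the projection
  obtain ⟨i, hi⟩ : ∃ i : (((Fin d → ℝ) × ℝ) ⧸ hspan F) →ₗ[ℝ] (Fin d → ℝ),
      Function.Injective i := by
    rw [← finrank_le_iff_exists_linearMap]
    have := Submodule.finrank_quotient_add_finrank (hspan F)
    rw [Module.finrank_prod, Module.finrank_fin_fun, Module.finrank_self] at this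
    rw [Module.finrank_fin_fun]
    unfold rk at hrk
    omega
  obtain ⟨r, hr⟩ := i.exists_leftInverse_of_injective (LinearMap.ker_eq_bot.2 hi)
  let L : ((Fin d → ℝ) × ℝ) →ₗ[ℝ] (Fin d → ℝ) := i.comp (hspan F).mkQ
  have hkerL : LinearMap.ker L = hspan F := by
    simp only [L]
    rw [LinearMap.ker_comp, LinearMap.ker_eq_bot.2 hi]
    exact (hspan F).ker_mkQ
  have hLF : ∀ s ∈ F, L (hat s) = 0 := by
    intro s hs
    have : hat s ∈ LinearMap.ker L := by rw [hkerL]; exact hat_mem_hspan hs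
    exact this
  have hfac : ∀ φ : ((Fin d → ℝ) × ℝ) →ₗ[ℝ] ℝ, (∀ s ∈ F, φ (hat s) = 0) →
      ∃ ℓ : (Fin d → ℝ) →ₗ[ℝ] ℝ, ∀ w, ℓ (L w) = φ w := by
    intro φ hφ
    refine ⟨((hspan F).liftQ φ (hspan_le_ker hφ)).comp r, fun w => ?_⟩
    have := LinearMap.congr_fun hr ((hspan F).mkQ w)
    simp only [LinearMap.comp_apply, LinearMap.id_apply] at this
    simp only [L, LinearMap.comp_apply, this]
    simp
  let q : (Fin d → ℝ) → (Fin d → ℝ) := fun s => (φ0 (hat s))⁻¹ • L (hat s)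
  let ψ : Set (Fin d → ℝ) → Set (Fin d → ℝ) := fun G =>
    convexHull ℝ (q '' {s | s ∈ S ∧ s ∈ G ∧ s ∉ F})
  let Q := ψ P
  have hkq : ∀ (χ : ((Fin d → ℝ) × ℝ) →ₗ[ℝ] ℝ), ∀ s ∈ S, s ∉ F →
      χ (L (hat s), φ0 (hat s)) = φ0 (hat s) * χ (hat (q s)) := by
    intro χ s hs hsF
    rw [← smul_eq_mul, ← map_smul]
    congr 1
    simp only [hat, q, Prod.smul_mk, smul_smul, smul_eq_mul, mul_one]
    have hne := (hcp s hs hsF).ne'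
    simp only [hat] at hne
    rw [mul_inv_cancel₀ hne, one_smul]
  have hface : ∀ G, IsFace P G → F ⊆ G → ∃ χ : ((Fin d → ℝ) × ℝ) →ₗ[ℝ] ℝ,
      (∀ y ∈ q '' {s | s ∈ S ∧ s ∈ P ∧ s ∉ F}, 0 ≤ χ (hat y)) ∧
      (∀ s ∈ S, s ∉ F → (χ (hat (q s)) = 0 ↔ s ∈ G)) := by
    intro G hG hFG
    obtain ⟨φ, h3, h4⟩ := isFace_iff.1 hG
    obtain ⟨ℓ, hℓ⟩ := hfac φ (by
      intro s hs
      have := hFG hs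
      rw [h4] at this
      exact this.2)
    have hval : ∀ s ∈ S, s ∉ F → φ (hat s) =
        φ0 (hat s) * (ℓ.comp (LinearMap.fst ℝ (Fin d → ℝ) ℝ)) (hat (q s)) := by
      intro s hs hsF
      rw [← hkq _ s hs hsF]
      simp [hℓ]
    refine ⟨ℓ.comp (LinearMap.fst ℝ _ _), ?_, ?_⟩
    · rintro _ ⟨s, ⟨hs, hsP, hsF⟩, rfl⟩
      have h5 := h3 s hsP
      rw [hval s hs hsF] at h5
      exact nonneg_of_mul_nonneg_right h5 (hcp s hs hsF)
    · intro s hs hsF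
      have hiff : s ∈ G ↔ φ (hat s) = 0 := by
        rw [h4]
        exact ⟨fun h => h.2, fun h => ⟨hSP s hs, h⟩⟩
      rw [hiff, hval s hs hsF, mul_eq_zero]
      have := (hcp s hs hsF).ne'
      tauto
  have hface' : ∀ G, IsFace P G → F ⊆ G → ∃ χ : ((Fin d → ℝ) × ℝ) →ₗ[ℝ] ℝ,
      ψ G = {y ∈ Q | χ (hat y) = 0} ∧ (∀ y ∈ Q, 0 ≤ χ (hat y)) ∧
      (∀ s ∈ S, s ∉ F → (χ (hat (q s)) = 0 ↔ s ∈ G)) := by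
    intro G hG hFG
    obtain ⟨χ, h3, h4⟩ := hface G hG hFG
    refine ⟨χ, ?_, (nonneg_conv h3).1, h4⟩
    simp only [Q, ψ]
    rw [(nonneg_conv h3).2]
    congr 1
    ext y
    constructor
    · rintro ⟨s, ⟨hs, hsG, hsF⟩, rfl⟩
      exact ⟨⟨s, ⟨hs, hSP s hs, hsF⟩, rfl⟩, (h4 s hs hsF).2 hsG⟩
    · rintro ⟨⟨s, ⟨hs, hsP, hsF⟩, rfl⟩, h0⟩
      exact ⟨s, ⟨hs, (h4 s hs hsF).1 h0, hsF⟩, rfl⟩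
  have hmono : ∀ G₁, IsFace P G₁ ∧ F ⊆ G₁ → ∀ G₂, IsFace P G₂ ∧ F ⊆ G₂ →
      (G₁ ⊆ G₂ ↔ ψ G₁ ⊆ ψ G₂) := by
    rintro G₁ ⟨hG₁, hF₁⟩ G₂ ⟨hG₂, hF₂⟩
    constructor
    · intro h
      apply convexHull_mono
      apply Set.image_mono
      rintro s ⟨a, b, c⟩
      exact ⟨a, h b, c⟩
    · intro h
      obtain ⟨χ, h3, _, h4⟩ := hface' G₂ hG₂ hF₂
      rw [hG₁.eq_conv, hG₂.eq_conv]
      apply convexHull_mono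
      rintro s ⟨hs, hsG⟩
      refine ⟨hs, ?_⟩
      by_cases hsF : s ∈ F
      · exact hF₂ hsF
      · have hm : q s ∈ ψ G₁ := subset_convexHull ℝ _ ⟨s, ⟨hs, hsG, hsF⟩, rfl⟩
        have hm2 := h hm
        rw [h3] at hm2
        exact (h4 s hs hsF).1 hm2.2
  refine ⟨Q, ψ, ⟨?_, ⟨?_, ?_, ?_⟩, ?_⟩, ?_⟩
  · have hfin : (q '' {s | s ∈ S ∧ s ∈ P ∧ s ∉ F}).Finite :=
      (S.finite_toSet.subset (fun s hs => hs.1)).image q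
    exact ⟨hfin.toFinset, by rw [hfin.coe_toFinset]⟩
  · rintro G ⟨hG, hFG⟩
    obtain ⟨χ, h3, h5, _⟩ := hface' G hG hFG
    exact isFace_iff.2 ⟨χ, h5, h3⟩
  · intro G₁ hG₁ G₂ hG₂ he
    exact ((hmono G₁ hG₁ G₂ hG₂).2 he.subset).antisymm ((hmono G₂ hG₂ G₁ hG₁).2 he.superset)
  · intro H hH
    obtain ⟨χ, h3, h4⟩ := isFace_iff.1 hH
    let φ : ((Fin d → ℝ) × ℝ) →ₗ[ℝ] ℝ := χ.comp (L.prod φ0)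
    have hφ : ∀ w, φ w = χ (L w, φ0 w) := fun w => rfl
    have hφF : ∀ s ∈ F, φ (hat s) = 0 := by
      intro s hs
      rw [hφ, hLF s hs, hzF s hs]
      exact map_zero χ
    have hqQ : ∀ s ∈ S, s ∉ F → q s ∈ Q := fun s hs hsF =>
      subset_convexHull ℝ _ ⟨s, ⟨hs, hSP s hs, hsF⟩, rfl⟩
    have hnn : ∀ s ∈ (S : Set (Fin d → ℝ)), 0 ≤ φ (hat s) := by
      intro s hs
      by_cases hsF : s ∈ F
      · rw [hφF s hsF]
      · rw [hφ, hkq χ s hs hsF]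
        exact mul_nonneg (hcp s hs hsF).le (h3 _ (hqQ s hs hsF))
    refine ⟨{x ∈ P | φ (hat x) = 0}, ⟨isFace_iff.2 ⟨φ, (nonneg_conv hnn).1, rfl⟩, ?_⟩, ?_⟩
    · intro s hs
      exact ⟨hF.subset hs, hφF s hs⟩
    · have h5 := IsFace.eq_conv hH
      rw [h5]
      simp only [ψ]
      congr 1
      ext y
      constructor
      · rintro ⟨s, ⟨hs, ⟨hsP, hs0⟩, hsF⟩, rfl⟩
        refine ⟨⟨s, ⟨hs, hsP, hsF⟩, rfl⟩, ?_⟩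
        rw [h4]
        refine ⟨hqQ s hs hsF, ?_⟩
        rw [hφ, hkq χ s hs hsF, mul_eq_zero] at hs0
        exact hs0.resolve_left (hcp s hs hsF).ne'
      · rintro ⟨⟨s, ⟨hs, hsP, hsF⟩, rfl⟩, hy⟩
        refine ⟨s, ⟨hs, ⟨hsP, ?_⟩, hsF⟩, rfl⟩
        rw [h4] at hy
        rw [hφ, hkq χ s hs hsF, hy.2, mul_zero]
  · intro G₁ hG₁ G₂ hG₂
    exact hmono G₁ hG₁ G₂ hG₂
  · intro G hG hFG
    let K : ((Fin d → ℝ) × ℝ) →ₗ[ℝ] ((Fin d → ℝ) × ℝ) := L.prod φ0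
    have hker : LinearMap.ker K = hspan F := by
      simp only [K]
      rw [LinearMap.ker_prod, hkerL]
      exact inf_eq_left.2 (hspan_le_ker hzF)
    have hKq : ∀ s ∈ S, s ∉ F → K (hat s) = φ0 (hat s) • hat (q s) := by
      intro s hs hsF
      simp only [K, LinearMap.prod_apply, hat, q, Prod.smul_mk, smul_smul, smul_eq_mul,
        mul_one]
      have := (hcp s hs hsF).ne'
      simp only [hat] at this
      rw [mul_inv_cancel₀ this, one_smul]
      rfl
    have hmap : hspan (ψ G) = (hspan G).map K := by
      have hGs : hspan G = hspan ((S : Set (Fin d → ℝ)) ∩ G) := by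
        rw [← hspan_conv ((S : Set (Fin d → ℝ)) ∩ G), ← hG.eq_conv]
      simp only [ψ]
      rw [hspan_conv]
      apply le_antisymm
      · unfold hspan
        rw [Submodule.span_le]
        rintro _ ⟨_, ⟨s, ⟨hs, hsG, hsF⟩, rfl⟩, rfl⟩
        refine ⟨(φ0 (hat s))⁻¹ • hat s, Submodule.smul_mem _ _ (hat_mem_hspan hsG), ?_⟩
        rw [map_smul, hKq s hs hsF, smul_smul, inv_mul_cancel₀ (hcp s hs hsF).ne', one_smul]
      · rw [hGs, Submodule.map_le_iff_le_comap]
        unfold hspan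
        rw [Submodule.span_le]
        rintro _ ⟨s, ⟨hs, hsG⟩, rfl⟩
        by_cases hsF : s ∈ F
        · have : K (hat s) = 0 := by
            have : hat s ∈ LinearMap.ker K := by rw [hker]; exact hat_mem_hspan hsF
            exact this
          rw [SetLike.mem_coe, Submodule.mem_comap]
          rw [this]; exact zero_mem _
        · rw [SetLike.mem_coe, Submodule.mem_comap]
          rw [hKq s hs hsF]
          apply Submodule.smul_mem
          exact Submodule.subset_span ⟨q s, ⟨s, ⟨hs, hsG, hsF⟩, rfl⟩, rfl⟩
    have := finrank_map_of_ker_le K (hspan G) (by rw [hker]; exact hspan_mono hFG)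
    rw [hker, ← hmap] at this
    exact this


/-- The finset of faces of `P` containing `F`. -/
def ivl {d : ℕ} (P F : Set (Fin d → ℝ)) : Finset (Set (Fin d → ℝ)) :=
  if h : {G : Set (Fin d → ℝ) | IsFace P G ∧ F ⊆ G}.Finite then h.toFinset else ∅

lemma ivl_finite {d : ℕ} {P : Set (Fin d → ℝ)} (hP : IsPolytope P) (F : Set (Fin d → ℝ)) :
    {G : Set (Fin d → ℝ) | IsFace P G ∧ F ⊆ G}.Finite :=
  (faces_finite hP).subset (fun _ hG => hG.1)

lemma coe_ivl {d : ℕ} {P : Set (Fin d → ℝ)} (hP : IsPolytope P) (F : Set (Fin d → ℝ)) :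
    (ivl P F : Set (Set (Fin d → ℝ))) = {G : Set (Fin d → ℝ) | IsFace P G ∧ F ⊆ G} := by
  unfold ivl
  rw [dif_pos (ivl_finite hP F), Set.Finite.coe_toFinset]

lemma mem_ivl {d : ℕ} {P F G : Set (Fin d → ℝ)} (hP : IsPolytope P) :
    G ∈ ivl P F ↔ IsFace P G ∧ F ⊆ G := by
  rw [← Finset.mem_coe, coe_ivl hP]
  rfl

lemma finsum_ivl {d : ℕ} {M : Type*} [AddCommMonoid M] {P : Set (Fin d → ℝ)} (hP : IsPolytope P)
    (F : Set (Fin d → ℝ)) (f : Set (Fin d → ℝ) → M) :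
    ∑ᶠ G ∈ {G : Set (Fin d → ℝ) | IsFace P G ∧ F ⊆ G}, f G = ∑ G ∈ ivl P F, f G := by
  rw [← coe_ivl hP, finsum_mem_coe_finset]

lemma euler_ivl {d : ℕ} {P F : Set (Fin d → ℝ)} (hP : IsPolytope P) (hF : IsFace P F)
    (hne : F ≠ P) : ∑ G ∈ ivl P F, (-1 : ℤ) ^ (rk G) = 0 := by
  rw [← finsum_ivl hP]
  exact euler hP hF hne

lemma IsFace.rk_lt {d : ℕ} {P F : Set (Fin d → ℝ)} (hF : IsFace P F) (hne : F ≠ P) :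
    rk F < rk P := by
  by_contra h
  exact hne (hF.eq_of_rk_le (le_refl _) hF.subset (by omega))

/-- The finset of vertices. -/
def VtF {d : ℕ} (P : Set (Fin d → ℝ)) : Finset (Fin d → ℝ) :=
  if h : (Vt P).Finite then h.toFinset else ∅

lemma mem_VtF {d : ℕ} {P : Set (Fin d → ℝ)} (hP : IsPolytope P) {v : Fin d → ℝ} :
    v ∈ VtF P ↔ IsFace P {v} := by
  unfold VtF
  rw [dif_pos (Vt_finite hP), Set.Finite.mem_toFinset]
  rfl

lemma coe_VtF {d : ℕ} {P : Set (Fin d → ℝ)} (hP : IsPolytope P) :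
    (VtF P : Set (Fin d → ℝ)) = Vt P := by
  unfold VtF
  rw [dif_pos (Vt_finite hP), Set.Finite.coe_toFinset]

lemma card_VtF {d : ℕ} {P : Set (Fin d → ℝ)} (hP : IsPolytope P) :
    (VtF P).card = (Vt P).ncard := by
  rw [← coe_VtF hP, Set.ncard_coe_finset]

lemma VtF_face {d : ℕ} {P F : Set (Fin d → ℝ)} (hP : IsPolytope P) (hF : IsFace P F) :
    VtF F = (VtF P).filter (fun v => v ∈ F) := by
  apply Finset.coe_injective
  rw [coe_VtF (hF.isPolytope hP), Vt_face hP hF, ← coe_VtF hP]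
  ext v
  simp

lemma sum_proper {d : ℕ} {P : Set (Fin d → ℝ)} (hP : IsPolytope P)
    (w : Set (Fin d → ℝ) → ℤ) :
    ∑ G ∈ (ivl P ∅).erase P, (-1 : ℤ) ^ (rk P - rk G - 1) * w G =
      w P - (-1) ^ (rk P) * ∑ G ∈ ivl P ∅, (-1 : ℤ) ^ (rk G) * w G := by
  have hPm : P ∈ ivl P ∅ := (mem_ivl hP).2 ⟨isFace_self P, Set.empty_subset _⟩
  rw [← Finset.add_sum_erase _ _ hPm]
  have : ∑ G ∈ (ivl P ∅).erase P, (-1 : ℤ) ^ (rk P - rk G - 1) * w G =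
      - ((-1) ^ (rk P) * ∑ G ∈ (ivl P ∅).erase P, (-1 : ℤ) ^ (rk G) * w G) := by
    rw [Finset.mul_sum, ← Finset.sum_neg_distrib]
    apply Finset.sum_congr rfl
    intro G hG
    rw [Finset.mem_erase, mem_ivl hP] at hG
    have hlt := hG.2.1.rk_lt hG.1
    obtain ⟨k, hk⟩ : ∃ k, rk P = rk G + 1 + k := ⟨rk P - rk G - 1, by omega⟩
    have h1 : rk P - rk G - 1 = k := by omega
    rw [h1, hk, pow_add, pow_add]
    have h2 : ((-1 : ℤ) ^ rk G) * (-1) ^ rk G = 1 := by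
      rw [← mul_pow]; simp
    linear_combination (-(-1 : ℤ) ^ k * w G) * h2
  rw [this]
  have h2 : ((-1 : ℤ) ^ rk P) * (-1) ^ rk P = 1 := by
    rw [← mul_pow]; simp
  linear_combination (w P) * h2

lemma coeff_X_sub_one_pow (k : ℕ) :
    (((X : Polynomial ℤ) - 1) ^ k).coeff 0 = (-1) ^ k ∧
    (((X : Polynomial ℤ) - 1) ^ k).coeff 1 = -(k : ℤ) * (-1) ^ k := by
  induction k with
  | zero => simp [Polynomial.coeff_one]
  | succ k ih =>
    rw [pow_succ, mul_sub, mul_one]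
    simp only [Polynomial.coeff_sub]
    rw [Polynomial.mul_coeff_zero, Polynomial.coeff_X_zero, Polynomial.coeff_mul_X, ih.1, ih.2]
    constructor
    · ring
    · push_cast; ring

lemma coeff_one_mul' (p q : Polynomial ℤ) :
    (p * q).coeff 1 = p.coeff 0 * q.coeff 1 + p.coeff 1 * q.coeff 0 := by
  rw [Polynomial.coeff_mul, Finset.Nat.sum_antidiagonal_succ]
  simp

lemma card_vt_rk_two {d : ℕ} {P : Set (Fin d → ℝ)} (hP : IsPolytope P) (h2 : rk P = 2) :
    (Vt P).ncard = 2 := by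
  have hne : ∅ ≠ P := by
    intro h
    rw [← h, rk_empty] at h2
    omega
  have he := euler_ivl hP (isFace_empty P) hne
  have hc : ∀ G ∈ ivl P ∅, (-1 : ℤ) ^ (rk G) = (if ∅ = G then 1 else 0) + (if P = G then 1 else 0)
      - (if rk G = 1 then 1 else 0) := by
    intro G hG
    rw [mem_ivl hP] at hG
    by_cases hGP : P = G
    · subst hGP
      rw [h2, if_neg hne]; simp
    · have hlt := hG.1.rk_lt (Ne.symm hGP)
      by_cases hGe : ∅ = G
      · subst hGe
        rw [rk_empty, if_neg hGP]; simp
      · have : rk G ≠ 0 := fun h => hGe (rk_eq_zero.1 h).symm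
        have h1 : rk G = 1 := by omega
        rw [if_neg hGP, if_neg hGe, h1]; simp
  rw [Finset.sum_congr rfl hc, Finset.sum_sub_distrib, Finset.sum_add_distrib, Finset.sum_ite_eq,
    Finset.sum_ite_eq, if_pos ((mem_ivl hP).2 ⟨isFace_empty P, subset_rfl⟩),
    if_pos ((mem_ivl hP).2 ⟨isFace_self P, Set.empty_subset _⟩), Finset.sum_boole] at he
  have h3 : (Vt P).ncard = ((ivl P ∅).filter (fun G => rk G = 1)).card := by
    rw [ncard_Vt, ← Set.ncard_coe_finset]
    congr 1
    ext G
    simp [mem_ivl hP]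
  rw [h3]
  have : (((ivl P ∅).filter (fun G => rk G = 1)).card : ℤ) = 2 := by linarith
  exact_mod_cast this

lemma g_coeffs {d : ℕ} {g h : Set (Fin d → ℝ) → Polynomial ℤ} (hGH : IsGH g h) :
    ∀ n : ℕ, ∀ P : Set (Fin d → ℝ), IsPolytope P → rk P = n →
      (g P).coeff 0 = 1 ∧ (g P).coeff 1 = ((Vt P).ncard : ℤ) - (rk P : ℤ) := by
  intro n
  induction n using Nat.strong_induction_on with
  | _ n ih =>
  intro P hP hn
  by_cases hemp : P = ∅
  · subst hemp
    rw [hGH.1]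
    have : (Vt (∅ : Set (Fin d → ℝ))) = ∅ := by
      rw [Set.eq_empty_iff_forall_notMem]
      intro v hv
      exact (hv.subset (Set.mem_singleton v)).elim
    rw [this, rk_empty]
    simp [Polynomial.coeff_one]
  obtain ⟨-, hh, hg⟩ := hGH
  obtain ⟨hg0, hg1, hg2⟩ := hg P hP hemp
  have hset : {F : Set (Fin d → ℝ) | IsFace P F ∧ F ≠ P} = ((ivl P ∅).erase P : Finset _) := by
    ext G
    simp [mem_ivl hP, and_comm]
  have hhP := hh P hP
  rw [hset, finsum_mem_coe_finset] at hhP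
  have hexp : ∀ G : Set (Fin d → ℝ), (pdim P - pdim G - 1).toNat = rk P - rk G - 1 := by
    intro G
    rw [pdim_eq, pdim_eq]; omega
  simp only [hexp] at hhP
  have hIH : ∀ G ∈ (ivl P ∅).erase P, (g G).coeff 0 = 1 ∧
      (g G).coeff 1 = ((Vt G).ncard : ℤ) - (rk G : ℤ) := by
    intro G hG
    rw [Finset.mem_erase, mem_ivl hP] at hG
    exact ih (rk G) (hn ▸ hG.2.1.rk_lt hG.1) G (hG.2.1.isPolytope hP) rfl
  have hE0 := euler_ivl hP (isFace_empty P) (Ne.symm hemp)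
  have hh0 : (h P).coeff 0 = 1 := by
    rw [hhP, Polynomial.finsetSum_coeff]
    have := sum_proper hP (fun _ => 1)
    simp only [mul_one, hE0] at this
    rw [mul_zero, sub_zero] at this
    rw [← this]
    apply Finset.sum_congr rfl
    intro G hG
    rw [Polynomial.mul_coeff_zero, (hIH G hG).1, (coeff_X_sub_one_pow _).1, mul_one]
  refine ⟨hg0.trans hh0, ?_⟩
  have hn0 : rk P ≠ 0 := fun h => hemp (rk_eq_zero.1 h)
  rcases (by omega : rk P = 1 ∨ rk P = 2 ∨ 3 ≤ rk P) with h1 | h2 | h3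
  · rw [hg2 1 one_pos (by rw [pdim_eq, h1]; norm_num)]
    obtain ⟨v, rfl⟩ := rk_eq_one.1 h1
    have : Vt ({v} : Set (Fin d → ℝ)) = {v} := by
      refine Set.Subset.antisymm (fun x hx => hx.subset rfl) ?_
      rintro _ rfl
      exact isFace_self _
    rw [this, h1]; simp
  · rw [hg2 1 one_pos (by rw [pdim_eq, h2]; norm_num), h2, card_vt_rk_two hP h2]
    norm_num
  · rw [hg1 1 one_pos (by rw [pdim_eq]; push_cast; omega)]
    have hh1 : (h P).coeff 1 = ((Vt P).ncard : ℤ) - (rk P - 1) := by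
      rw [hhP, Polynomial.finsetSum_coeff]
      have hs := sum_proper hP (fun G => ((Vt G).ncard : ℤ) - (rk P - 1))
      have hz : ∑ G ∈ ivl P ∅, (-1 : ℤ) ^ (rk G) * (((Vt G).ncard : ℤ) - (rk P - 1)) = 0 := by
        have hv : ∀ v ∈ VtF P, ∑ G ∈ ivl P ∅, (if v ∈ G then (-1 : ℤ) ^ (rk G) else 0) = 0 := by
          intro v hv
          rw [mem_VtF hP] at hv
          have hvP : {v} ≠ P := by
            intro h
            rw [← h, rk_eq_one.2 ⟨v, rfl⟩] at h3
            omega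
          rw [← Finset.sum_filter, ← euler_ivl hP hv hvP]
          apply Finset.sum_congr _ (fun _ _ => rfl)
          ext G
          simp [mem_ivl hP]
        have hG : ∀ G ∈ ivl P ∅, (-1 : ℤ) ^ (rk G) * (((Vt G).ncard : ℤ) - (rk P - 1)) =
            (∑ v ∈ VtF P, (if v ∈ G then (-1 : ℤ) ^ (rk G) else 0)) -
              (-1 : ℤ) ^ (rk G) * (rk P - 1) := by
          intro G hG
          rw [mem_ivl hP] at hG
          rw [mul_sub, ← card_VtF (hG.1.isPolytope hP), VtF_face hP hG.1, ← Finset.sum_filter,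
            Finset.sum_const, nsmul_eq_mul]
          ring
        rw [Finset.sum_congr rfl hG, Finset.sum_sub_distrib, Finset.sum_comm,
          Finset.sum_eq_zero hv, ← Finset.sum_mul, hE0]
        ring
      rw [hz, mul_zero, sub_zero] at hs
      rw [← hs]
      apply Finset.sum_congr rfl
      intro G hG
      rw [coeff_one_mul', (hIH G hG).1, (hIH G hG).2, (coeff_X_sub_one_pow _).1,
        (coeff_X_sub_one_pow _).2]
      rw [Finset.mem_erase, mem_ivl hP] at hG
      have hlt := hG.2.1.rk_lt hG.1
      have : ((rk P - rk G - 1 : ℕ) : ℤ) = rk P - rk G - 1 := by omega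
      rw [this]
      ring
    rw [hh1, hh0]
    ring


lemma quotient_g_coeffs {d : ℕ} {g h : Set (Fin d → ℝ) → Polynomial ℤ} (hGH : IsGH g h)
    {P F Q : Set (Fin d → ℝ)} {ψ : Set (Fin d → ℝ) → Set (Fin d → ℝ)} (hP : IsPolytope P)
    (hF : IsFace P F) (hQ : IsQuotientPair P F Q ψ)
    (hrk : ∀ G, IsFace P G → F ⊆ G → rk (ψ G) + rk F = rk G) :
    (g Q).coeff 0 = 1 ∧
    (g Q).coeff 1 = (((ivl P F).filter (fun G => rk F + 1 = rk G)).card : ℤ) - (rk P - rk F) := by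
  obtain ⟨hQp, hbij, hmono⟩ := hQ
  obtain ⟨h0, h1⟩ := g_coeffs hGH _ Q hQp rfl
  refine ⟨h0, ?_⟩
  have hψP : ψ P = Q := by
    have hPm : P ∈ {G : Set (Fin d → ℝ) | IsFace P G ∧ F ⊆ G} := ⟨isFace_self P, hF.subset⟩
    apply Set.Subset.antisymm
    · exact IsFace.subset (hbij.mapsTo hPm)
    · obtain ⟨G, hG, hGQ⟩ := hbij.surjOn (isFace_self Q)
      rw [← hGQ]
      exact (hmono G hG P hPm).1 hG.1.subset
  have hr := hrk P (isFace_self P) hF.subset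
  rw [hψP] at hr
  have hc : (Vt Q).ncard = ((ivl P F).filter (fun G => rk F + 1 = rk G)).card := by
    rw [ncard_Vt, ← Set.ncard_coe_finset]
    have himg : {G : Set (Fin d → ℝ) | IsFace Q G ∧ rk G = 1} =
        ψ '' (((ivl P F).filter (fun G => rk F + 1 = rk G) : Finset _) :
          Set (Set (Fin d → ℝ))) := by
      ext H
      constructor
      · rintro ⟨hH, hH1⟩
        obtain ⟨G, hG, rfl⟩ := hbij.surjOn hH
        refine ⟨G, ?_, rfl⟩
        rw [Finset.mem_coe, Finset.mem_filter, mem_ivl hP]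
        have := hrk G hG.1 hG.2
        exact ⟨hG, by omega⟩
      · rintro ⟨G, hG, rfl⟩
        rw [Finset.mem_coe, Finset.mem_filter, mem_ivl hP] at hG
        have := hrk G hG.1.1 hG.1.2
        exact ⟨hbij.mapsTo hG.1, by omega⟩
    rw [himg]
    apply Set.ncard_image_of_injOn
    apply hbij.injOn.mono
    intro G hG
    rw [Finset.mem_coe, Finset.mem_filter, mem_ivl hP] at hG
    exact hG.1
  rw [h1, hc]
  have : (rk Q : ℤ) = rk P - rk F := by omega
  rw [this]

lemma rel_sum {d : ℕ} {g h : Set (Fin d → ℝ) → Polynomial ℤ}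
    {gr : Set (Fin d → ℝ) → Set (Fin d → ℝ) → Polynomial ℤ}
    (hGH : IsGH g h) (hgr : IsRelG g gr)
    {P F : Set (Fin d → ℝ)} (hP : IsPolytope P) (hF : IsFace P F) :
    ∑ E ∈ ivl P F, (gr E F).coeff 0 = 1 ∧
    ∑ E ∈ ivl P F, ((gr E F).coeff 1 + (gr E F).coeff 0 *
      ((((ivl P E).filter (fun G => rk E + 1 = rk G)).card : ℤ) - (rk P - rk E))) =
      ((Vt P).ncard : ℤ) - rk P := by
  have hex : ∀ E : Set (Fin d → ℝ), ∃ Q ψ, IsFace P E → (IsQuotientPair P E Q ψ ∧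
      ∀ G, IsFace P G → E ⊆ G → rk (ψ G) + rk E = rk G) := by
    intro E
    by_cases hE : IsFace P E
    · obtain ⟨Q, ψ, hq⟩ := exists_quotient hP hE
      exact ⟨Q, ψ, fun _ => hq⟩
    · exact ⟨∅, id, fun h => (hE h).elim⟩
  choose Q ψ hq using hex
  have hs := hgr P F Q ψ hP hF (fun E hE _ => (hq E hE).1)
  rw [finsum_ivl hP] at hs
  obtain ⟨h0, h1⟩ := g_coeffs hGH _ P hP rfl
  constructor
  · rw [← h0, ← hs, Polynomial.finsetSum_coeff]
    apply Finset.sum_congr rfl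
    intro E hE
    rw [mem_ivl hP] at hE
    rw [Polynomial.mul_coeff_zero,
      (quotient_g_coeffs hGH hP hE.1 (hq E hE.1).1 (hq E hE.1).2).1, mul_one]
  · rw [← h1, ← hs, Polynomial.finsetSum_coeff]
    apply Finset.sum_congr rfl
    intro E hE
    rw [mem_ivl hP] at hE
    rw [coeff_one_mul',
      (quotient_g_coeffs hGH hP hE.1 (hq E hE.1).1 (hq E hE.1).2).1,
      (quotient_g_coeffs hGH hP hE.1 (hq E hE.1).1 (hq E hE.1).2).2]
    ring

lemma gr_zero {d : ℕ} {g h : Set (Fin d → ℝ) → Polynomial ℤ}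
    {gr : Set (Fin d → ℝ) → Set (Fin d → ℝ) → Polynomial ℤ}
    (hGH : IsGH g h) (hgr : IsRelG g gr) (F : Set (Fin d → ℝ)) :
    ∀ n : ℕ, ∀ P : Set (Fin d → ℝ), IsPolytope P → IsFace P F → rk P = n →
      (gr P F).coeff 0 = if F = P then 1 else 0 := by
  intro n
  induction n using Nat.strong_induction_on with
  | _ n ih =>
  intro P hP hF hn
  have hs := (rel_sum hGH hgr hP hF).1
  have hPm : P ∈ ivl P F := (mem_ivl hP).2 ⟨isFace_self P, hF.subset⟩
  have hFm : F ∈ ivl P F := (mem_ivl hP).2 ⟨hF, subset_rfl⟩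
  have h1 : ∑ E ∈ ivl P F, (if F = E then (1 : ℤ) else 0) = 1 := by
    rw [Finset.sum_ite_eq, if_pos hFm]
  rw [← h1, ← Finset.add_sum_erase _ _ hPm,
    ← Finset.add_sum_erase _ (fun E => if F = E then (1 : ℤ) else 0) hPm] at hs
  have h2 : ∑ E ∈ (ivl P F).erase P, (gr E F).coeff 0 =
      ∑ E ∈ (ivl P F).erase P, (if F = E then (1 : ℤ) else 0) := by
    apply Finset.sum_congr rfl
    intro E hE
    rw [Finset.mem_erase, mem_ivl hP] at hE
    exact ih (rk E) (hn ▸ hE.2.1.rk_lt hE.1) E (hE.2.1.isPolytope hP)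
      (IsFace.restrict hF hE.2.1.subset hE.2.2) rfl
  rw [h2] at hs
  exact add_right_cancel hs

/-- Vertices of `P` lying in no proper face containing `F`. -/
def MV {d : ℕ} (P F : Set (Fin d → ℝ)) : Finset (Fin d → ℝ) :=
  (VtF P).filter (fun v => ∀ G ∈ ivl P F, v ∈ G → G = P)

lemma sum_card_MV {d : ℕ} {P F : Set (Fin d → ℝ)} (hP : IsPolytope P) (hF : IsFace P F) :
    ∑ E ∈ ivl P F, (MV E F).card = (Vt P).ncard := by
  have hPm : P ∈ ivl P F := (mem_ivl hP).2 ⟨isFace_self P, hF.subset⟩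
  have hex : ∀ v : Fin d → ℝ, ∃ E, v ∈ VtF P → (E ∈ ivl P F ∧ v ∈ E ∧
      ∀ G ∈ ivl P F, v ∈ G → E ⊆ G) := by
    intro v
    by_cases hv : v ∈ VtF P
    · have hvP : v ∈ P := ((mem_VtF hP).1 hv).subset rfl
      obtain ⟨E, hE, hmin⟩ := Finset.exists_min_image ((ivl P F).filter (fun G => v ∈ G)) rk
        ⟨P, Finset.mem_filter.2 ⟨hPm, hvP⟩⟩
      rw [Finset.mem_filter, mem_ivl hP] at hE
      refine ⟨E, fun _ => ⟨(mem_ivl hP).2 hE.1, hE.2, ?_⟩⟩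
      intro G hG hvG
      rw [mem_ivl hP] at hG
      have hI : IsFace P (G ∩ E) := hG.1.inter hE.1.1
      have hle := hmin (G ∩ E) (Finset.mem_filter.2 ⟨(mem_ivl hP).2
        ⟨hI, Set.subset_inter hG.2 hE.1.2⟩, hvG, hE.2⟩)
      have := hI.eq_of_rk_le hE.1.1.subset Set.inter_subset_right hle
      exact Set.inter_eq_right.1 this
    · exact ⟨∅, fun h => (hv h).elim⟩
  choose m hm using hex
  rw [← card_VtF hP, Finset.card_eq_sum_card_fiberwise (f := m) (t := ivl P F)
    (fun v hv => (hm v hv).1)]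
  apply Finset.sum_congr rfl
  intro E hE
  congr 1
  have hE2 := (mem_ivl hP).1 hE
  have hEp := hE2.1.isPolytope hP
  ext v
  unfold MV
  rw [VtF_face hP hE2.1]
  simp only [Finset.mem_filter]
  constructor
  · rintro ⟨⟨hv, hvE⟩, hall⟩
    refine ⟨hv, ?_⟩
    obtain ⟨h1, h2, h3⟩ := hm v hv
    have h4 := (mem_ivl hP).1 h1
    exact hall (m v) ((mem_ivl hEp).2 ⟨h4.1.restrict hE2.1.subset (h3 E hE hvE), h4.2⟩) h2
  · rintro ⟨hv, rfl⟩
    obtain ⟨h1, h2, h3⟩ := hm v hv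
    refine ⟨⟨hv, h2⟩, fun G hG hvG => ?_⟩
    rw [mem_ivl hEp] at hG
    exact hG.1.subset.antisymm (h3 G ((mem_ivl hP).2 ⟨hE2.1.trans hP hG.1, hG.2⟩) hvG)

lemma finrank_quot {d : ℕ} {V N : Set (Fin d → ℝ)} (hV : V.Finite) (hN : N ⊆ V) :
    (Module.finrank ℝ (↥(AffDep V) ⧸ Submodule.comap (AffDep V).subtype (AffDep N)) : ℤ) =
      (V.ncard - N.ncard : ℤ) - (rk V - rk N) := by
  have hle : AffDep N ≤ AffDep V := by
    rintro a ⟨h1, h2, h3⟩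
    exact ⟨h1, h2.trans hN, h3⟩
  obtain ⟨h1, hfd⟩ := finrank_AffDep hV
  obtain ⟨h2, -⟩ := finrank_AffDep (hV.subset hN)
  have h3 := Submodule.finrank_quotient_add_finrank
    (Submodule.comap (AffDep V).subtype (AffDep N))
  rw [(Submodule.comapSubtypeEquivOfLe hle).finrank_eq] at h3
  omega

lemma rdim_eq {d : ℕ} {P F : Set (Fin d → ℝ)} (hP : IsPolytope P) (hF : IsFace P F) :
    (Module.finrank ℝ (↥(AffDep (Vt P)) ⧸
      Submodule.comap (AffDep (Vt P)).subtype (AffDep (Vt P ∩ NPF P F))) : ℤ) =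
      (MV P F).card - (if rk F + 1 = rk P then 1 else 0) - (if F = P then (rk P : ℤ) else 0) := by
  rw [finrank_quot (Vt_finite hP) Set.inter_subset_left, rk_Vt hP]
  have hNP : ∀ x, x ∈ NPF P F ↔ ∃ G, (IsFace P G ∧ rk G + 1 = rk P ∧ F ⊆ G) ∧ x ∈ G := by
    intro x
    unfold NPF
    rw [Set.mem_sUnion]
    apply exists_congr
    intro G
    rw [Set.mem_ofPred_eq, pdim_eq, pdim_eq]
    have : ((rk G : ℤ) - 1 = rk P - 1 - 1) ↔ rk G + 1 = rk P := by omega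
    rw [this]
  by_cases hFP : F = P
  · subst hFP
    have hN : Vt F ∩ NPF F F = ∅ := by
      rw [Set.eq_empty_iff_forall_notMem]
      rintro v ⟨-, hv⟩
      obtain ⟨G, ⟨h1, h2, h3⟩, -⟩ := (hNP v).1 hv
      have := rk_mono h3
      omega
    have hM : MV F F = VtF F := by
      unfold MV
      apply Finset.filter_true_of_mem
      intro v _ G hG _
      rw [mem_ivl hP] at hG
      exact hG.1.subset.antisymm hG.2
    rw [hN, hM, card_VtF hP, rk_empty]
    simp
  have hlt := hF.rk_lt hFP
  rw [if_neg hFP, sub_zero]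
  have hcard : ((MV P F).card : ℤ) = (Vt P).ncard - (Vt P ∩ NPF P F).ncard := by
    have hM : ((MV P F : Finset _) : Set (Fin d → ℝ)) = Vt P \ (Vt P ∩ NPF P F) := by
      ext v
      unfold MV
      rw [Finset.mem_coe, Finset.mem_filter, Set.diff_self_inter, Set.mem_diff, ← coe_VtF hP,
        Finset.mem_coe]
      apply and_congr_right
      intro hv
      constructor
      · intro hall hvN
        obtain ⟨G, ⟨h1, h2, h3⟩, h4⟩ := (hNP v).1 hvN
        have := hall G ((mem_ivl hP).2 ⟨h1, h3⟩) h4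
        rw [this] at h2
        omega
      · intro hvN G hG hvG
        rw [mem_ivl hP] at hG
        by_contra hne
        obtain ⟨x, hx, hxG⟩ := Set.exists_of_ssubset (hG.1.subset.ssubset_of_ne hne)
        obtain ⟨G', h1, h2, -, h4⟩ := exists_facet hP hG.1 hx hxG
        exact hvN ((hNP v).2 ⟨G', ⟨h1, h4, hG.2.trans h2⟩, h2 hvG⟩)
    have h1 := Set.ncard_diff_add_ncard_of_subset
      (Set.inter_subset_left : Vt P ∩ NPF P F ⊆ Vt P) (Vt_finite hP)
    rw [← hM, Set.ncard_coe_finset] at h1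
    omega
  rw [hcard]
  by_cases hfac : rk F + 1 = rk P
  · rw [if_pos hfac]
    have hN : Vt P ∩ NPF P F = Vt F := by
      rw [Vt_face hP hF]
      congr 1
      ext x
      rw [hNP]
      constructor
      · rintro ⟨G, ⟨h1, h2, h3⟩, h4⟩
        rw [hF.eq_of_rk_le h1.subset h3 (by omega)]
        exact h4
      · intro hx
        exact ⟨F, ⟨hF, hfac, subset_rfl⟩, hx⟩
    rw [hN, rk_Vt (hF.isPolytope hP)]
    omega
  · rw [if_neg hfac]
    have hrk : rk (Vt P ∩ NPF P F) = rk P := by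
      apply le_antisymm
      · rw [← rk_Vt hP]
        exact rk_mono Set.inter_subset_left
      · obtain ⟨x, hx, hxF⟩ := Set.exists_of_ssubset (hF.subset.ssubset_of_ne hFP)
        obtain ⟨G1, h1, h2, -, h4⟩ := exists_facet hP hF hx hxF
        have hne : F ≠ G1 := by
          rintro rfl
          exact hfac h4
        obtain ⟨y, hy, hyF⟩ := Set.exists_of_ssubset (h2.ssubset_of_ne hne)
        obtain ⟨G2, k1, k2, k3, k4⟩ := exists_facet hP hF (h1.subset hy) hyF
        have hG1 := h1.isPolytope hP
        have hG2 := k1.isPolytope hP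
        obtain ⟨v, hv, hvG⟩ : ∃ v ∈ Vt G2, v ∉ G1 := by
          by_contra hcon
          push Not at hcon
          have hsub : G2 ⊆ G1 := by
            rw [conv_Vt hG2, conv_Vt hG1]
            apply convexHull_mono
            intro v hv
            rw [Vt_face hP h1]
            rw [Vt_face hP k1] at hv
            refine ⟨hv.1, hcon v ?_⟩
            rw [Vt_face hP k1]
            exact hv
          have := k1.eq_of_rk_le h1.subset hsub (by omega)
          rw [this] at k3
          exact k3 hy
        rw [Vt_face hP k1] at hv
        have hsub1 : Vt G1 ⊆ Vt P ∩ NPF P F := by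
          rw [Vt_face hP h1]
          rintro w ⟨hw, hw1⟩
          exact ⟨hw, (hNP w).2 ⟨G1, ⟨h1, h4, h2⟩, hw1⟩⟩
        have := rk_lt_of_notMem hsub1 (x := v) ⟨hv.1, (hNP v).2 ⟨G2, ⟨k1, k4, k2⟩, hv.2⟩⟩
          (fun hh => h1.hat_notMem (k1.subset hv.2) hvG (hspan_mono Vt_subset hh))
        rw [rk_Vt hG1] at this
        omega
    rw [hrk]
    omega

lemma relative_g_one_aux {d : ℕ} {g h : Set (Fin d → ℝ) → Polynomial ℤ}
    {gr : Set (Fin d → ℝ) → Set (Fin d → ℝ) → Polynomial ℤ}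
    (hGH : IsGH g h) (hgr : IsRelG g gr) (F : Set (Fin d → ℝ)) :
    ∀ n : ℕ, ∀ P : Set (Fin d → ℝ), IsPolytope P → IsFace P F → rk P = n →
      (gr P F).coeff 1 =
        (MV P F).card - (if rk F + 1 = rk P then 1 else 0) -
          (if F = P then (rk P : ℤ) else 0) := by
  intro n
  induction n using Nat.strong_induction_on with
  | _ n ih =>
  intro P hP hF hn
  have hs := (rel_sum hGH hgr hP hF).2
  have hPm : P ∈ ivl P F := (mem_ivl hP).2 ⟨isFace_self P, hF.subset⟩
  have hFm : F ∈ ivl P F := (mem_ivl hP).2 ⟨hF, subset_rfl⟩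
  let r : Set (Fin d → ℝ) → ℤ := fun E => (MV E F).card - (if rk F + 1 = rk E then 1 else 0) -
          (if F = E then (rk E : ℤ) else 0)
  have hface : ∀ E ∈ ivl P F, IsPolytope E ∧ IsFace E F := by
    intro E hE
    rw [mem_ivl hP] at hE
    exact ⟨hE.1.isPolytope hP, IsFace.restrict hF hE.1.subset hE.2⟩
  have h0 : ∑ E ∈ ivl P F, (gr E F).coeff 0 *
      ((((ivl P E).filter (fun G => rk E + 1 = rk G)).card : ℤ) - (rk P - rk E)) =
      (((ivl P F).filter (fun G => rk F + 1 = rk G)).card : ℤ) - (rk P - rk F) := by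
    rw [Finset.sum_eq_single_of_mem F hFm]
    · rw [gr_zero hGH hgr F _ F (hface F hFm).1 (isFace_self F) rfl, if_pos rfl, one_mul]
    · intro E hE hne
      rw [gr_zero hGH hgr F _ E (hface E hE).1 (hface E hE).2 rfl, if_neg (Ne.symm hne), zero_mul]
  have hr : ∑ E ∈ ivl P F, r E = (Vt P).ncard -
      ((ivl P F).filter (fun G => rk F + 1 = rk G)).card - rk F := by
    simp only [r]
    rw [Finset.sum_sub_distrib, Finset.sum_sub_distrib, Finset.sum_ite_eq, if_pos hFm,
      Finset.sum_boole, ← sum_card_MV hP hF]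
    push_cast
    rfl
  rw [Finset.sum_add_distrib, h0] at hs
  have heq : ∑ E ∈ ivl P F, (gr E F).coeff 1 = ∑ E ∈ ivl P F, r E := by
    rw [hr]; linarith
  rw [← Finset.add_sum_erase _ _ hPm, ← Finset.add_sum_erase _ r hPm] at heq
  have h2 : ∑ E ∈ (ivl P F).erase P, (gr E F).coeff 1 = ∑ E ∈ (ivl P F).erase P, r E := by
    apply Finset.sum_congr rfl
    intro E hE
    rw [Finset.mem_erase] at hE
    exact ih (rk E) (hn ▸ ((mem_ivl hP).1 hE.2).1.rk_lt hE.1) E (hface E hE.2).1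
      (hface E hE.2).2 rfl
  rw [h2] at heq
  exact add_right_cancel heq


/-- For any convex polytope `P` and face `F` of `P`,
`g₁(P,F) = dim_ℝ (Aff(V_P)/Aff(V_N))`, where `V_P` is the vertex set of `P` and
`V_N` the set of vertices of `P` lying in `N(P,F)` (with `Aff(V_N) ⊆ Aff(V_P)`
by extension by zero). -/
theorem relative_g_one {d : ℕ} (g h : Set (Fin d → ℝ) → Polynomial ℤ)
    (gr : Set (Fin d → ℝ) → Set (Fin d → ℝ) → Polynomial ℤ)
    (hGH : IsGH g h) (hgr : IsRelG g gr)
    (P F : Set (Fin d → ℝ)) (hP : IsPolytope P) (hF : IsFace P F) :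
    (gr P F).coeff 1 =
      Module.finrank ℝ
        (↥(AffDep {v : Fin d → ℝ | IsFace P {v}}) ⧸
          Submodule.comap (AffDep {v : Fin d → ℝ | IsFace P {v}}).subtype
            (AffDep ({v : Fin d → ℝ | IsFace P {v}} ∩ NPF P F))) := by
  rw [relative_g_one_aux hGH hgr F _ P hP hF rfl]
  exact (rdim_eq hP hF).symm

end
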